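/- arXiv:math/0404419 — 3 statements merged into one kernel-verified Lean document; each statement's English description precedes it below -/
import Mathlib

section
/- Let A be a connected finitely generated locally finite graded k-algebra that is effectively coherent. Then every finitely presented graded right A-module is effective for series; in particular, for every d the set of Hilbert series of homogeneous right ideals of A generated in degrees ≤ d is finite. -/
open MulOpposite

namespace NCG

variable (k : Type) [Field k] (R : Type) [Ring R] [Algebra k R]

/-- `𝒜` is a connected grading on the `k`-algebra `R`: the graded pieces multiply
correctly, `R` is their internal direct sum, and the degree-zero piece is `k·1`. -/
def IsConnAlg (𝒜 : ℕ → Submodule k R) : Prop :=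
  (∀ (i j : ℕ), ∀ x ∈ 𝒜 i, ∀ y ∈ 𝒜 j, x * y ∈ 𝒜 (i + j)) ∧
  DirectSum.IsInternal 𝒜 ∧
  𝒜 0 = Submodule.span k {(1 : R)}

/-- `R` is locally finite: every graded piece is finite-dimensional over `k`. -/
def LocFin (𝒜 : ℕ → Submodule k R) : Prop := ∀ i, FiniteDimensional k (𝒜 i)

/-- `R` is a finitely generated `k`-algebra. -/
def FinGenAlg : Prop := ∃ s : Finset R, Algebra.adjoin k (s : Set R) = ⊤

/-- extension of the grading to `ℤ` (zero in negative degrees). -/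
noncomputable def grZ (𝒜 : ℕ → Submodule k R) : ℤ → Submodule k R :=
  fun j => if 0 ≤ j then 𝒜 j.toNat else ⊥

/-- the augmentation ideal `R_{≥1}`, as a right ideal of `R`. -/
def aug (𝒜 : ℕ → Submodule k R) : Submodule Rᵐᵒᵖ R :=
  Submodule.span Rᵐᵒᵖ (⋃ i : ℕ, ⋃ _ : 1 ≤ i, ((𝒜 i : Set R)))

variable (M : Type) [AddCommGroup M] [Module Rᵐᵒᵖ M] [Module k M]

/-- `ℳ` makes `M` a graded right module over the graded algebra `(R, 𝒜)`. -/
def IsGradedMod (𝒜 : ℕ → Submodule k R) (ℳ : ℤ → Submodule k M) : Prop :=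
  (∀ (i : ℕ) (j : ℤ), ∀ r ∈ 𝒜 i, ∀ x ∈ ℳ j, (op r) • x ∈ ℳ (j + i)) ∧
  DirectSum.IsInternal ℳ

/-- the submodule `N` of `M` is generated in degrees at most `dd`. -/
def GenLE (ℳ : ℤ → Submodule k M) (N : Submodule Rᵐᵒᵖ M) (dd : ℤ) : Prop :=
  N ≤ Submodule.span Rᵐᵒᵖ {x : M | x ∈ N ∧ ∃ j ≤ dd, x ∈ ℳ j}

/-- the submodule `N` is a graded (homogeneous) submodule of `M`. -/
def IsGradedSub (ℳ : ℤ → Submodule k M) (N : Submodule Rᵐᵒᵖ M) : Prop :=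
  N ≤ Submodule.span Rᵐᵒᵖ {x : M | x ∈ N ∧ ∃ j : ℤ, x ∈ ℳ j}

/-- the Hilbert series of a submodule `N` of `M`, as its coefficient function. -/
noncomputable def hilb (ℳ : ℤ → Submodule k M) [IsScalarTower k Rᵐᵒᵖ M]
    (N : Submodule Rᵐᵒᵖ M) : ℤ → ℕ :=
  fun j => Module.finrank k ↥(ℳ j ⊓ N.restrictScalars k)

/-- the Hilbert series of a right ideal of `R`, as its coefficient function. -/
noncomputable def hilbI (𝒜 : ℕ → Submodule k R) (I : Submodule Rᵐᵒᵖ R) : ℕ → ℕ :=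
  fun j => Module.finrank k ↥(𝒜 j ⊓ I.restrictScalars k)

/-- the Hilbert series of the algebra `R`, as its coefficient function. -/
noncomputable def hilbA (𝒜 : ℕ → Submodule k R) : ℕ → ℕ :=
  fun j => Module.finrank k ↥(𝒜 j)

/-- `v` is a solution of the homogeneous linear equation `a₁x₁ + ⋯ + aₙxₙ = 0`. -/
def IsSol {n : ℕ} (a : Fin n → M) (v : Fin n → R) : Prop :=
  ∑ i, op (v i) • a i = 0

/-- `w` is a homogeneous element of degree `j` of the free module `⊕ᵢ R(-dg i)`. -/
def FreeHomog (𝒜 : ℕ → Submodule k R) {n : ℕ} (dg : Fin n → ℤ)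
    (w : Fin n → R) (j : ℤ) : Prop :=
  ∀ i, w i ∈ grZ k R 𝒜 (j - dg i)

/-- The module of solutions of the equation with homogeneous coefficients `a` (of
degrees `dg`) is generated in degrees at most `D`: every solution is an `R`-linear
combination of homogeneous solutions of degree at most `D`. -/
def SolGenLE (𝒜 : ℕ → Submodule k R) {n : ℕ} (a : Fin n → M) (dg : Fin n → ℤ)
    (D : ℤ) : Prop :=
  ∀ v : Fin n → R, IsSol R M a v →
    v ∈ Submodule.span Rᵐᵒᵖ
      {w : Fin n → R | IsSol R M a w ∧ ∃ j ≤ D, FreeHomog k R 𝒜 dg w j}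

/-- The module of solutions of the equation with coefficients `a` is generated by the
(finitely many) solutions `h`. -/
def SolSpanBy {n : ℕ} (a : Fin n → M) {m : ℕ} (h : Fin m → (Fin n → R)) : Prop :=
  (∀ j, IsSol R M a (h j)) ∧
  ∀ v : Fin n → R, IsSol R M a v → v ∈ Submodule.span Rᵐᵒᵖ (Set.range h)

/-- `D` witnesses the effective coherence of the graded module `M`. -/
def WitnessEC (𝒜 : ℕ → Submodule k R) (ℳ : ℤ → Submodule k M) (D : ℕ → ℕ) : Prop :=
  (∀ d, d ≤ D d) ∧
  ∀ (d n : ℕ) (a : Fin n → M) (dg : Fin n → ℤ),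
    (∀ i, a i ∈ ℳ (dg i)) → (∀ i, dg i ≤ (d : ℤ)) →
    SolGenLE k R M 𝒜 a dg ((D d : ℕ) : ℤ)

/-- the graded module `M` is effectively coherent. -/
def EffCoh (𝒜 : ℕ → Submodule k R) (ℳ : ℤ → Submodule k M) : Prop :=
  ∃ D : ℕ → ℕ, WitnessEC k R M 𝒜 ℳ D

/-- the algebra `R` is effectively coherent (as a right module over itself). -/
noncomputable def EffCohAlg (𝒜 : ℕ → Submodule k R) : Prop :=
  EffCoh k R R 𝒜 (grZ k R 𝒜)

/-- `M` is a finitely presented graded right `R`-module. -/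
def ModFinPres (𝒜 : ℕ → Submodule k R) (ℳ : ℤ → Submodule k M) : Prop :=
  ∃ (t : ℕ) (b : Fin t → M) (db : Fin t → ℤ),
    (∀ i, b i ∈ ℳ (db i)) ∧ Submodule.span Rᵐᵒᵖ (Set.range b) = ⊤ ∧
    ∃ (m : ℕ) (h : Fin m → (Fin t → R)) (e : Fin m → ℤ),
      (∀ j, FreeHomog k R 𝒜 db (h j) (e j)) ∧ SolSpanBy R M b h

/-- `R` is a finitely presented algebra: there is an exact sequence
`F₂ → F₁ → R → k_R → 0` of graded right modules with `F₁, F₂` finite graded free. -/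
def AlgFinPres (𝒜 : ℕ → Submodule k R) : Prop :=
  ∃ (n : ℕ) (g : Fin n → R) (dg : Fin n → ℕ),
    (∀ i, g i ∈ 𝒜 (dg i)) ∧
    Submodule.span Rᵐᵒᵖ (Set.range g) = aug k R 𝒜 ∧
    ∃ (m : ℕ) (h : Fin m → (Fin n → R)) (e : Fin m → ℤ),
      (∀ j, FreeHomog k R 𝒜 (fun i => (dg i : ℤ)) (h j) (e j)) ∧
      SolSpanBy R R g h

/-- `R` admits an exact sequence `F₃ → F₂ → F₁ → R → k_R → 0` of graded right modules
with all `Fᵢ` finite graded free (finitely presented with `dim Tor₃ < ∞`). -/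
def AlgFinPres3 (𝒜 : ℕ → Submodule k R) : Prop :=
  ∃ (n : ℕ) (g : Fin n → R) (dg : Fin n → ℕ),
    (∀ i, g i ∈ 𝒜 (dg i)) ∧
    Submodule.span Rᵐᵒᵖ (Set.range g) = aug k R 𝒜 ∧
    ∃ (m : ℕ) (h : Fin m → (Fin n → R)) (e : Fin m → ℤ),
      (∀ j, FreeHomog k R 𝒜 (fun i => (dg i : ℤ)) (h j) (e j)) ∧
      SolSpanBy R R g h ∧
      ∃ (p : ℕ) (u : Fin p → (Fin m → R)) (f : Fin p → ℤ),
        (∀ l, FreeHomog k R 𝒜 e (u l) (f l)) ∧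
        SolSpanBy R (Fin n → R) h u

/-- membership in the class `D(n,a,b,c)`: there is an exact sequence
`F₃ → F₂ → F₁ → R → k_R → 0` with `F₁` of rank at most `n` and basis in degrees `≤ a`,
`F₂` with basis in degrees `≤ b` and `F₃` with basis in degrees `≤ c`. -/
def InDClass (𝒜 : ℕ → Submodule k R) (n a b c : ℕ) : Prop :=
  ∃ (n' : ℕ), n' ≤ n ∧ ∃ (g : Fin n' → R) (dg : Fin n' → ℕ),
    (∀ i, dg i ≤ a) ∧ (∀ i, g i ∈ 𝒜 (dg i)) ∧
    Submodule.span Rᵐᵒᵖ (Set.range g) = aug k R 𝒜 ∧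
    ∃ (m : ℕ) (h : Fin m → (Fin n' → R)) (e : Fin m → ℤ),
      (∀ j, e j ≤ (b : ℤ)) ∧
      (∀ j, FreeHomog k R 𝒜 (fun i => (dg i : ℤ)) (h j) (e j)) ∧
      SolSpanBy R R g h ∧
      SolGenLE k R (Fin n' → R) 𝒜 h e (c : ℤ)

/-- the right ideal `I` has a finite homogeneous generating family in degrees `≤ d`. -/
def FinGenLE (𝒜 : ℕ → Submodule k R) (I : Submodule Rᵐᵒᵖ R) (d : ℕ) : Prop :=
  ∃ (n : ℕ) (x : Fin n → R) (dx : Fin n → ℕ),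
    (∀ i, dx i ≤ d) ∧ (∀ i, x i ∈ 𝒜 (dx i)) ∧
    Submodule.span Rᵐᵒᵖ (Set.range x) = I

/-- lexicographic strict order on `ℕ`-indexed coefficient functions: `f <_lex g`. -/
def LexLtN (f g : ℕ → ℕ) : Prop := ∃ q, (∀ i < q, f i = g i) ∧ f q < g q

/-- lexicographic strict order on `ℤ`-indexed coefficient functions: `f <_lex g`. -/
def LexLtZ (f g : ℤ → ℕ) : Prop := ∃ q, (∀ i < q, f i = g i) ∧ f q < g q

/-- the right annihilator ideal of an element `a : R`. -/
def rAnn (a : R) : Submodule Rᵐᵒᵖ R where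
  carrier := {r : R | a * r = 0}
  add_mem' := by
    intro x y hx hy
    simp only [Set.mem_setOf_eq] at *
    rw [mul_add, hx, hy, add_zero]
  zero_mem' := by simp
  smul_mem' := by
    intro c x hx
    simp only [Set.mem_setOf_eq] at *
    rw [← op_unop c, op_smul_eq_mul, ← mul_assoc, hx, zero_mul]

/-- the colon right ideal `(x : J) = { a ∈ R | x·a ∈ J }`. -/
def colon (x : R) (J : Submodule Rᵐᵒᵖ R) : Submodule Rᵐᵒᵖ R where
  carrier := {a : R | x * a ∈ J}
  add_mem' := by
    intro p q hp hq
    simp only [Set.mem_setOf_eq] at *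
    rw [mul_add]; exact J.add_mem hp hq
  zero_mem' := by simp
  smul_mem' := by
    intro c p hp
    simp only [Set.mem_setOf_eq] at *
    rw [← op_unop c, op_smul_eq_mul, ← mul_assoc]
    exact J.smul_mem (op (unop c)) hp

/-- `F` is a coherent family of right ideals of `R`. -/
def IsCohFam (𝒜 : ℕ → Submodule k R) (F : Set (Submodule Rᵐᵒᵖ R)) : Prop :=
  (∀ I ∈ F, I.FG ∧ IsGradedSub k R R (grZ k R 𝒜) I) ∧
  (⊥ : Submodule Rᵐᵒᵖ R) ∈ F ∧ aug k R 𝒜 ∈ F ∧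
  ∀ I ∈ F, I ≠ ⊥ → ∃ J ∈ F, J ≠ I ∧ ∃ x : R, (∃ dx : ℕ, x ∈ 𝒜 dx) ∧ x ∈ I ∧
    I = J ⊔ Submodule.span Rᵐᵒᵖ {x} ∧
    (∀ dI : ℤ, GenLE k R R (grZ k R 𝒜) I dI → GenLE k R R (grZ k R 𝒜) J dI) ∧
    colon R x J ∈ F

/-- the family `F` of ideals has degree at most `d`. -/
def CohFamDegLE (𝒜 : ℕ → Submodule k R) (F : Set (Submodule Rᵐᵒᵖ R)) (d : ℕ) : Prop :=
  ∀ I ∈ F, GenLE k R R (grZ k R 𝒜) I (d : ℤ)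

/-- the right ideal `I` is finitely presented as a graded module. -/
def IdealFinPres (𝒜 : ℕ → Submodule k R) (I : Submodule Rᵐᵒᵖ R) : Prop :=
  ∃ (n : ℕ) (x : Fin n → R) (dx : Fin n → ℕ),
    (∀ i, x i ∈ 𝒜 (dx i)) ∧ Submodule.span Rᵐᵒᵖ (Set.range x) = I ∧
    ∃ (m : ℕ) (h : Fin m → (Fin n → R)) (e : Fin m → ℤ),
      (∀ j, FreeHomog k R 𝒜 (fun i => (dx i : ℤ)) (h j) (e j)) ∧
      SolSpanBy R R x h

/-- `R` is graded right coherent: every finitely generated homogeneous right ideal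
is finitely presented as a graded module. -/
def GradedCoherent (𝒜 : ℕ → Submodule k R) : Prop :=
  ∀ I : Submodule Rᵐᵒᵖ R, I.FG → IsGradedSub k R R (grZ k R 𝒜) I →
    IdealFinPres k R 𝒜 I

/-- a free resolution of the right ideal `I` by finite graded free modules whose
bases at level `i` sit in degrees at most `B i`. -/
def FreeResBdd (𝒜 : ℕ → Submodule k R) (I : Submodule Rᵐᵒᵖ R) (B : ℕ → ℤ) : Prop :=
  ∃ (r : ℕ → ℕ) (dgs : (i : ℕ) → Fin (r i) → ℤ)
    (g0 : Fin (r 0) → R)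
    (g : (i : ℕ) → Fin (r (i + 1)) → (Fin (r i) → R)),
    (∀ l, dgs 0 l ≤ B 0) ∧
    (∀ l, g0 l ∈ grZ k R 𝒜 (dgs 0 l)) ∧
    Submodule.span Rᵐᵒᵖ (Set.range g0) = I ∧
    (∀ (i : ℕ) (l : Fin (r (i + 1))), dgs (i + 1) l ≤ B (i + 1)) ∧
    (∀ (i : ℕ) (l : Fin (r (i + 1))), FreeHomog k R 𝒜 (dgs i) (g i l) (dgs (i + 1) l)) ∧
    SolSpanBy R R g0 (g 0) ∧
    (∀ i : ℕ, SolSpanBy R (Fin (r i) → R) (g i) (g (i + 1)))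

/-- the Artin–Zhang property for a graded module `M`. -/
def ArtinZhang (ℳ : ℤ → Submodule k M) [IsScalarTower k Rᵐᵒᵖ M] : Prop :=
  ∀ h : ℤ → ℕ, ∃ d : ℤ, 0 < d ∧
    (∀ L : Submodule Rᵐᵒᵖ M, L.FG → hilb k R M ℳ L = h → GenLE k R M ℳ L d) ∧
    (∀ L : Submodule Rᵐᵒᵖ M, GenLE k R M ℳ L d →
      (∀ j ≤ d, hilb k R M ℳ L j = h j) → hilb k R M ℳ L = h)

/-- `M` is effective for series: for each `d`, only finitely many Hilbert series of
submodules generated in degrees `≤ d`. -/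
def EffForSeries (ℳ : ℤ → Submodule k M) [IsScalarTower k Rᵐᵒᵖ M] : Prop :=
  ∀ d : ℤ, {h : ℤ → ℕ | ∃ L : Submodule Rᵐᵒᵖ M,
    GenLE k R M ℳ L d ∧ h = hilb k R M ℳ L}.Finite

/-- `M` is effective for generators: the Hilbert series of a finitely generated
submodule bounds the degrees of its generators. -/
def EffForGen (ℳ : ℤ → Submodule k M) [IsScalarTower k Rᵐᵒᵖ M] : Prop :=
  ∀ h : ℤ → ℕ, ∃ d : ℤ,
    ∀ L : Submodule Rᵐᵒᵖ M, L.FG → hilb k R M ℳ L = h → GenLE k R M ℳ L d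

/-- bundled data of a graded `k`-algebra. -/
structure AlgData (k : Type) [Field k] : Type 1 where
  carrier : Type
  [ringStr : Ring carrier]
  [algStr : Algebra k carrier]
  grading : ℕ → Submodule k carrier

attribute [instance] AlgData.ringStr AlgData.algStr

/-- bundled data of a graded right `R`-module. -/
structure ModData (k R : Type) [Field k] [Ring R] [Algebra k R] : Type 1 where
  carrier : Type
  [acg : AddCommGroup carrier]
  [modR : Module Rᵐᵒᵖ carrier]
  [modk : Module k carrier]
  [tower : IsScalarTower k Rᵐᵒᵖ carrier]
  grading : ℤ → Submodule k carrier

attribute [instance] ModData.acg ModData.modR ModData.modk ModData.tower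


theorem noeth {k : Type} [Field k] {W M J : Type} [AddCommGroup W] [Module k W]
    [FiniteDimensional k W] [AddCommGroup M] [Module k M] {T : J → Type}
    (w : ∀ j, T j → W →ₗ[k] M)
    (hf : ∀ c j, FiniteDimensional k (Submodule.span k (Set.range (fun t => w j t c))))
    (h : J → ℕ) :
    ∃ N : Finset J, ∀ c,
      (∀ j ∈ N, Module.finrank k (Submodule.span k (Set.range (fun t => w j t c))) ≤ h j) →
      ∀ j, Module.finrank k (Submodule.span k (Set.range (fun t => w j t c))) ≤ h j := by
  classical
  let B := Module.finBasis k W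
  let poly : ∀ j (s : Fin (h j + 1) → T j) (φ : M →ₗ[k] (Fin (h j + 1) → k)),
      MvPolynomial (Fin (Module.finrank k W)) k := fun j s φ =>
    Matrix.det (Matrix.of fun x y => ∑ τ, MvPolynomial.C (φ (w j (s x) (B τ)) y) *
      MvPolynomial.X τ)
  have heval : ∀ c j s φ, MvPolynomial.eval (fun τ => B.repr c τ) (poly j s φ) =
      Matrix.det (Matrix.of fun x y => φ (w j (s x) c) y) := by
    intro c j s φ
    simp only [poly]
    rw [RingHom.map_det]
    congr 1
    ext x y
    simp only [RingHom.mapMatrix_apply, Matrix.map_apply, Matrix.of_apply, map_sum, map_mul,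
      MvPolynomial.eval_C, MvPolynomial.eval_X]
    conv_rhs => rw [← B.sum_repr c]
    simp only [map_sum, map_smul, Finset.sum_apply, Pi.smul_apply, smul_eq_mul, mul_comm]
  let S : Set (MvPolynomial (Fin (Module.finrank k W)) k) :=
    {p | ∃ j s φ, p = poly j s φ}
  have hfg : (Submodule.span (MvPolynomial (Fin (Module.finrank k W)) k) S).FG :=
    IsNoetherian.noetherian _
  rw [Submodule.fg_span_iff_fg_span_finset_subset] at hfg
  obtain ⟨S', hS', hspan⟩ := hfg
  choose J' s' φ' hJ using (fun p : S' => hS' p.2)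
  refine ⟨S'.attach.image J', fun c hc j => ?_⟩
  have hvan : ∀ p ∈ S, MvPolynomial.eval (fun τ => B.repr c τ) p = 0 := by
    have h1 : S ⊆ (RingHom.ker (MvPolynomial.eval (fun τ => B.repr c τ)) : Ideal _) := by
      have h2 : Submodule.span _ S ≤ (RingHom.ker (MvPolynomial.eval (fun τ => B.repr c τ)) :
          Ideal (MvPolynomial (Fin (Module.finrank k W)) k)) := by
        rw [hspan, Submodule.span_le]
        intro p hp
        obtain ⟨p, rfl⟩ : ∃ p' : S', p'.1 = p := ⟨⟨p, hp⟩, rfl⟩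
        have hpS := hJ p
        have hN := hc (J' p) (Finset.mem_image_of_mem _ (Finset.mem_attach _ _))
        change MvPolynomial.eval _ p.1 = 0
        rw [hpS, heval]
        by_contra hdet
        have hli : LinearIndependent k (fun x => φ' p (w (J' p) (s' p x) c)) := by
          have := Matrix.linearIndependent_rows_of_det_ne_zero hdet
          exact this
        have hli2 : LinearIndependent k (fun x => w (J' p) (s' p x) c) :=
          LinearIndependent.of_comp (φ' p) hli
        have hli3 : LinearIndependent k (fun x => (⟨w (J' p) (s' p x) c,
            Submodule.subset_span ⟨_, rfl⟩⟩ :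
            Submodule.span k (Set.range (fun t => w (J' p) t c)))) :=
          LinearIndependent.of_comp (Submodule.subtype _) hli2
        have := hf c (J' p)
        have := hli3.fintype_card_le_finrank
        simp at this
        omega
      exact fun p hp => h2 (Submodule.subset_span hp)
    exact fun p hp => h1 hp
  by_contra hlt
  push Not at hlt
  obtain ⟨s, hs⟩ : ∃ s : Fin (h j + 1) → T j, LinearIndependent k (fun x => w j (s x) c) := by
    have := hf c j
    obtain ⟨f, hf1, -, hf2⟩ := Submodule.exists_fun_fin_finrank_span_eq k
      (Set.range (fun t => w j t c))
    choose g hg using hf1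
    refine ⟨fun x => g (Fin.castLE hlt x), ?_⟩
    have := hf2.comp (Fin.castLE hlt) (Fin.castLE_injective hlt)
    convert this using 2 with x
    exact hg _
  obtain ⟨φ, hφ⟩ := LinearMap.exists_leftInverse_of_injective
    (Fintype.linearCombination k (fun x => w j (s x) c)) (by
      rw [LinearMap.ker_eq_bot]
      exact linearIndependent_iff_injective_fintypeLinearCombination.mp hs)
  have h0 := hvan _ ⟨j, s, φ, rfl⟩
  rw [heval] at h0
  have : (Matrix.of fun x y => φ (w j (s x) c) y) = (1 : Matrix _ _ k) := by
    ext x y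
    have := LinearMap.congr_fun hφ (Pi.single x 1)
    simp [Fintype.linearCombination_apply_single] at this
    simp [this, Matrix.one_apply, Pi.single_apply, eq_comm]
  rw [this] at h0
  simp at h0

section aux

variable {k : Type} [Field k] {R : Type} [Ring R] [Algebra k R]
variable {M : Type} [AddCommGroup M] [Module Rᵐᵒᵖ M] [Module k M]

theorem int_proj {V ι : Type} [AddCommGroup V] [Module k V] [DecidableEq ι]
    (ℳ : ι → Submodule k V) (h : DirectSum.IsInternal ℳ) (j : ι) :
    ∃ π : V →ₗ[k] V, (∀ x, π x ∈ ℳ j) ∧ (∀ x ∈ ℳ j, π x = x) ∧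
      ∀ j', j' ≠ j → ∀ x ∈ ℳ j', π x = 0 := by
  let e : DirectSum ι (fun i => ℳ i) ≃ₗ[k] V :=
    LinearEquiv.ofBijective (DirectSum.coeLinearMap ℳ) h
  have he : ∀ i (x : ℳ i), e.symm (x : V) = DirectSum.lof k ι (fun i => ℳ i) i x := by
    intro i x
    rw [LinearEquiv.symm_apply_eq]
    change (x : V) = DirectSum.coeLinearMap ℳ _
    simp
  refine ⟨(ℳ j).subtype ∘ₗ DirectSum.component k ι (fun i => ℳ i) j ∘ₗ e.symm.toLinearMap,
    fun x => ?_, fun x hx => ?_, fun j' hj x hx => ?_⟩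
  · simp
  · have := he j ⟨x, hx⟩
    simp only at this
    simp [this, DirectSum.component.lof_self]
  · have := he j' ⟨x, hx⟩
    simp only at this
    simp [this, DirectSum.component.of, hj]

theorem grZ_natCast (𝒜 : ℕ → Submodule k R) (i : ℕ) : grZ k R 𝒜 (i : ℤ) = 𝒜 i := by
  simp [grZ]

theorem grZ_neg (𝒜 : ℕ → Submodule k R) {i : ℤ} (h : i < 0) : grZ k R 𝒜 i = ⊥ := by
  simp [grZ, not_le.mpr h]

theorem one_mem_grZ {𝒜 : ℕ → Submodule k R} (hc : IsConnAlg k R 𝒜) :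
    (1 : R) ∈ grZ k R 𝒜 0 := by
  have : (1 : R) ∈ 𝒜 0 := by
    rw [hc.2.2]; exact Submodule.mem_span_singleton_self _
  simpa [grZ] using this

theorem grZ_mul {𝒜 : ℕ → Submodule k R} (hc : IsConnAlg k R 𝒜) {i j l : ℤ} {x y : R}
    (hx : x ∈ grZ k R 𝒜 i) (hy : y ∈ grZ k R 𝒜 j) (hl : l = i + j) :
    x * y ∈ grZ k R 𝒜 l := by
  subst hl
  rcases lt_or_ge i 0 with hi | hi
  · rw [grZ_neg _ hi] at hx
    rw [(Submodule.mem_bot k).mp hx]; simp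
  rcases lt_or_ge j 0 with hj | hj
  · rw [grZ_neg _ hj] at hy
    rw [(Submodule.mem_bot k).mp hy]; simp
  lift i to ℕ using hi
  lift j to ℕ using hj
  rw [grZ_natCast] at hx hy
  rw [← Nat.cast_add, grZ_natCast]
  exact hc.1 i j x hx y hy

theorem grZ_proj {𝒜 : ℕ → Submodule k R} (hc : IsConnAlg k R 𝒜) (j : ℤ) :
    ∃ π : R →ₗ[k] R, (∀ x, π x ∈ grZ k R 𝒜 j) ∧ (∀ x ∈ grZ k R 𝒜 j, π x = x) ∧
      ∀ j', j' ≠ j → ∀ x ∈ grZ k R 𝒜 j', π x = 0 := by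
  rcases lt_or_ge j 0 with hj | hj
  · refine ⟨0, by simp, fun x hx => ?_, by simp⟩
    rw [grZ_neg _ hj] at hx
    rw [(Submodule.mem_bot k).mp hx]; simp
  · lift j to ℕ using hj
    obtain ⟨π, h1, h2, h3⟩ := int_proj 𝒜 hc.2.1 j
    rw [grZ_natCast]
    refine ⟨π, h1, h2, fun j' hj' x hx => ?_⟩
    rcases lt_or_ge j' 0 with hj0 | hj0
    · rw [grZ_neg _ hj0] at hx
      rw [(Submodule.mem_bot k).mp hx]; simp
    · lift j' to ℕ using hj0
      rw [grZ_natCast] at hx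
      exact h3 j' (by exact_mod_cast hj') x hx

theorem grZ_fin {𝒜 : ℕ → Submodule k R} (hlf : LocFin k R 𝒜) (j : ℤ) :
    FiniteDimensional k (grZ k R 𝒜 j) := by
  rcases lt_or_ge j 0 with hj | hj
  · rw [grZ_neg _ hj]; infer_instance
  · lift j to ℕ using hj
    rw [grZ_natCast]; exact hlf j

theorem grZ_induction {𝒜 : ℕ → Submodule k R} (hc : IsConnAlg k R 𝒜) {p : R → Prop}
    (h0 : p 0) (hadd : ∀ x y, p x → p y → p (x + y))
    (hh : ∀ j, ∀ x ∈ grZ k R 𝒜 j, p x) (r : R) : p r := by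
  have : r ∈ ⨆ i, 𝒜 i := by
    rw [hc.2.1.submodule_iSup_eq_top]; trivial
  induction this using Submodule.iSup_induction' with
  | mem i x hx => exact hh i x (by rwa [grZ_natCast])
  | zero => exact h0
  | add x y _ _ hx hy => exact hadd x y hx hy

/-- graded module with projections -/
structure GM (𝒜 : ℕ → Submodule k R) (ℳ : ℤ → Submodule k M) : Prop where
  smul : ∀ (i j l : ℤ) (r : R) (x : M), r ∈ grZ k R 𝒜 i → x ∈ ℳ j → l = j + i →
    op r • x ∈ ℳ l
  proj : ∀ j, ∃ π : M →ₗ[k] M, (∀ x ∈ ℳ j, π x = x) ∧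
      ∀ j', j' ≠ j → ∀ x ∈ ℳ j', π x = 0

/-- homogeneous component of a free module -/
noncomputable def FreeGr (𝒜 : ℕ → Submodule k R) {n : ℕ} (dg : Fin n → ℤ) (j : ℤ) :
    Submodule k (Fin n → R) :=
  Submodule.pi Set.univ (fun i => grZ k R 𝒜 (j - dg i))

theorem mem_FreeGr {𝒜 : ℕ → Submodule k R} {n : ℕ} {dg : Fin n → ℤ} {j : ℤ}
    {w : Fin n → R} : w ∈ FreeGr 𝒜 dg j ↔ FreeHomog k R 𝒜 dg w j := by
  simp [FreeGr, FreeHomog, Submodule.mem_pi]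

theorem FreeGr_fin {𝒜 : ℕ → Submodule k R} (hlf : LocFin k R 𝒜) {n : ℕ} (dg : Fin n → ℤ)
    (j : ℤ) : FiniteDimensional k (FreeGr 𝒜 dg j) := by
  have := fun i => grZ_fin hlf (j - dg i)
  let f : FreeGr 𝒜 dg j →ₗ[k] (∀ i, grZ k R 𝒜 (j - dg i)) :=
    LinearMap.pi fun i => LinearMap.codRestrict _
      (LinearMap.proj i ∘ₗ (FreeGr 𝒜 dg j).subtype) (fun w => mem_FreeGr.mp w.2 i)
  refine FiniteDimensional.of_injective f fun v w h => ?_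
  ext i
  have := congr_fun h i
  exact congr_arg Subtype.val this

theorem FreeGr_bdd (𝒜 : ℕ → Submodule k R) {n : ℕ} (dg : Fin n → ℤ) :
    ∃ b, ∀ j < b, FreeGr 𝒜 dg j = ⊥ := by
  obtain ⟨b, hb⟩ := (Set.finite_range dg).bddBelow
  refine ⟨b, fun j hj => ?_⟩
  rw [eq_bot_iff]
  intro w hw
  rw [mem_FreeGr] at hw
  ext i
  have h1 := hw i
  have : b ≤ dg i := hb ⟨i, rfl⟩
  rw [grZ_neg _ (by omega)] at h1
  simpa using h1

theorem FreeGr_GM {𝒜 : ℕ → Submodule k R} (hc : IsConnAlg k R 𝒜) {n : ℕ} (dg : Fin n → ℤ) :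
    GM 𝒜 (FreeGr 𝒜 dg) where
  smul i j l r x hr hx hl := by
    rw [mem_FreeGr] at *
    intro s
    exact grZ_mul hc (hx s) hr (by omega)
  proj j := by
    choose π h1 h2 h3 using grZ_proj hc
    refine ⟨LinearMap.pi fun i => π (j - dg i) ∘ₗ LinearMap.proj i, fun x hx => ?_,
      fun j' hj x hx => ?_⟩
    · rw [mem_FreeGr] at hx
      ext i
      exact h2 _ _ (hx i)
    · rw [mem_FreeGr] at hx
      ext i
      exact h3 _ (j' - dg i) (by omega) _ (hx i)

theorem grZ_GM {𝒜 : ℕ → Submodule k R} (hc : IsConnAlg k R 𝒜) :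
    GM (M := R) 𝒜 (grZ k R 𝒜) where
  smul i j l r x hr hx hl := grZ_mul hc hx hr hl
  proj j := by
    obtain ⟨π, -, h⟩ := grZ_proj hc j
    exact ⟨π, h⟩

theorem mod_GM {𝒜 : ℕ → Submodule k R} {ℳ : ℤ → Submodule k M}
    (h : IsGradedMod k R M 𝒜 ℳ) : GM 𝒜 ℳ where
  smul i j l r x hr hx hl := by
    subst hl
    rcases lt_or_ge i 0 with hi | hi
    · rw [grZ_neg _ hi] at hr
      rw [(Submodule.mem_bot k).mp hr]; simp
    · lift i to ℕ using hi
      rw [grZ_natCast] at hr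
      exact h.1 i j r hr x hx
  proj j := by
    obtain ⟨π, -, h⟩ := int_proj ℳ h.2 j
    exact ⟨π, h⟩

/-- the map from the free module given by `a` -/
def Phi {n : ℕ} (a : Fin n → M) : (Fin n → R) →ₗ[Rᵐᵒᵖ] M where
  toFun v := ∑ i, op (v i) • a i
  map_add' v w := by simp [add_smul, Finset.sum_add_distrib]
  map_smul' c v := by
    simp only [Pi.smul_apply, RingHom.id_apply, Finset.smul_sum, smul_smul]
    rfl

theorem Phi_apply {n : ℕ} (a : Fin n → M) (v : Fin n → R) :
    Phi a v = ∑ i, op (v i) • a i := rfl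

theorem mem_ker_Phi {n : ℕ} (a : Fin n → M) (v : Fin n → R) :
    v ∈ LinearMap.ker (Phi a) ↔ IsSol R M a v := Iff.rfl

theorem range_Phi {n : ℕ} (a : Fin n → M) :
    LinearMap.range (Phi (R := R) a) = Submodule.span Rᵐᵒᵖ (Set.range a) := by
  ext x
  rw [Submodule.mem_span_range_iff_exists_fun]
  constructor
  · rintro ⟨v, rfl⟩; exact ⟨fun i => op (v i), rfl⟩
  · rintro ⟨c, rfl⟩; exact ⟨fun i => unop (c i), rfl⟩

variable [IsScalarTower k Rᵐᵒᵖ M]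

theorem Phi_mem {𝒜 : ℕ → Submodule k R} {ℳ : ℤ → Submodule k M} (hM : GM 𝒜 ℳ) {n : ℕ}
    {a : Fin n → M} {dg : Fin n → ℤ} (ha : ∀ i, a i ∈ ℳ (dg i)) {j : ℤ} {v : Fin n → R}
    (hv : FreeHomog k R 𝒜 dg v j) : Phi a v ∈ ℳ j := by
  rw [Phi_apply]
  exact Submodule.sum_mem _ fun i _ => hM.smul (j - dg i) (dg i) j _ _ (hv i) (ha i) (by omega)

theorem desc {𝒜 : ℕ → Submodule k R} (hc : IsConnAlg k R 𝒜)
    {ℳ : ℤ → Submodule k M} (hM : GM 𝒜 ℳ) {n : ℕ}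
    {a : Fin n → M} {dg : Fin n → ℤ} (ha : ∀ i, a i ∈ ℳ (dg i)) (j : ℤ) :
    ℳ j ⊓ (Submodule.span Rᵐᵒᵖ (Set.range a)).restrictScalars k =
      (FreeGr 𝒜 dg j).map ((Phi a).restrictScalars k) := by
  apply le_antisymm
  · rintro x ⟨hx, hxL⟩
    have hxL' : x ∈ Submodule.span Rᵐᵒᵖ (Set.range a) := hxL
    rw [← range_Phi] at hxL'
    obtain ⟨v, rfl⟩ := hxL'
    obtain ⟨π, h1, h2⟩ := hM.proj j
    choose p p1 p2 p3 using grZ_proj hc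
    refine ⟨fun i => p (j - dg i) (v i), mem_FreeGr.mpr fun i => p1 _ _, ?_⟩
    rw [← h1 _ hx]
    change Phi a _ = _
    rw [Phi_apply, Phi_apply, map_sum]
    refine Finset.sum_congr rfl fun i _ => ?_
    refine grZ_induction hc (p := fun r => op (p (j - dg i) r) • a i = π (op r • a i))
      (by simp) (fun x y hx hy => by simp [add_smul, hx, hy]) (fun l r hr => ?_) (v i)
    have hm := hM.smul l (dg i) _ r (a i) hr (ha i) rfl
    by_cases hl : dg i + l = j
    · have : l = j - dg i := by omega
      subst this
      rw [p2 _ _ hr, h1 _ (hl ▸ hm)]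
    · rw [p3 _ l (by omega) _ hr, h2 _ hl _ hm]; simp
  · rintro _ ⟨v, hv, rfl⟩
    refine ⟨Phi_mem hM ha (mem_FreeGr.mp hv), ?_⟩
    change Phi a v ∈ Submodule.span Rᵐᵒᵖ (Set.range a)
    rw [← range_Phi]
    exact ⟨v, rfl⟩

theorem hilb_add {𝒜 : ℕ → Submodule k R} (hc : IsConnAlg k R 𝒜) (hlf : LocFin k R 𝒜)
    {ℳ : ℤ → Submodule k M} (hM : GM 𝒜 ℳ) {n : ℕ}
    {a : Fin n → M} {dg : Fin n → ℤ} (ha : ∀ i, a i ∈ ℳ (dg i)) (j : ℤ) :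
    hilb k R M ℳ (Submodule.span Rᵐᵒᵖ (Set.range a)) j +
      hilb k R (Fin n → R) (FreeGr 𝒜 dg) (LinearMap.ker (Phi a)) j =
    Module.finrank k (FreeGr 𝒜 dg j) := by
  have := FreeGr_fin hlf dg j
  have h := LinearMap.finrank_range_add_finrank_ker
    (((Phi a).restrictScalars k) ∘ₗ (FreeGr 𝒜 dg j).subtype)
  rw [← h]
  unfold hilb
  rw [desc hc hM ha j, LinearMap.range_comp, Submodule.range_subtype, LinearMap.ker_comp]
  congr 1
  have e := (Submodule.equivMapOfInjective (FreeGr 𝒜 dg j).subtype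
    (Submodule.injective_subtype _) ((LinearMap.ker ((Phi a).restrictScalars k)).comap
      (FreeGr 𝒜 dg j).subtype)).finrank_eq
  rw [e, Submodule.map_comap_subtype]
  rfl

theorem lemmaA {𝒜 : ℕ → Submodule k R} (hc : IsConnAlg k R 𝒜)
    {ℳ : ℤ → Submodule k M} (hM : GM 𝒜 ℳ) (hfin : ∀ j, FiniteDimensional k (ℳ j)) {n : ℕ}
    (dg : Fin n → ℤ) (h : ℤ → ℕ) :
    ∃ N : Finset ℤ, ∀ a : Fin n → M, (∀ i, a i ∈ ℳ (dg i)) →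
      (∀ j ∈ N, hilb k R M ℳ (Submodule.span Rᵐᵒᵖ (Set.range a)) j ≤ h j) →
      ∀ j, hilb k R M ℳ (Submodule.span Rᵐᵒᵖ (Set.range a)) j ≤ h j := by
  let w : ∀ j : ℤ, FreeGr 𝒜 dg j → (∀ i, ℳ (dg i)) →ₗ[k] M := fun j v =>
    ∑ i, (Module.toModuleEnd k M (op (v.1 i))) ∘ₗ (ℳ (dg i)).subtype ∘ₗ LinearMap.proj i
  have hw : ∀ j v c, w j v c = Phi (fun i => (c i : M)) v.1 := by
    intro j v c
    simp [w, Phi_apply]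
  have hspan : ∀ (c : ∀ i, ℳ (dg i)) j, Submodule.span k (Set.range (fun t => w j t c)) =
      ℳ j ⊓ (Submodule.span Rᵐᵒᵖ (Set.range (fun i => (c i : M)))).restrictScalars k := by
    intro c j
    rw [desc hc hM (fun i => (c i).2)]
    have : Set.range (fun t => w j t c) =
        ((FreeGr 𝒜 dg j).map ((Phi (fun i => (c i : M))).restrictScalars k) : Set M) := by
      ext x
      constructor
      · rintro ⟨v, rfl⟩
        exact ⟨v.1, v.2, (hw j v c).symm⟩
      · rintro ⟨v, hv, rfl⟩
        exact ⟨⟨v, hv⟩, hw j _ c⟩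
    rw [this, Submodule.span_eq]
  obtain ⟨N, hN⟩ := noeth w (by
    intro c j
    rw [hspan]
    have := hfin j
    exact Submodule.finiteDimensional_inf_left _ _) h
  refine ⟨N, fun a ha hj => ?_⟩
  have hfr : ∀ j, hilb k R M ℳ (Submodule.span Rᵐᵒᵖ (Set.range a)) j =
      Module.finrank k (Submodule.span k
        (Set.range (fun t => w j t (fun i => ⟨a i, ha i⟩)))) := by
    intro j
    rw [hspan]
    rfl
  simp only [hfr] at hj ⊢
  exact hN (fun i => ⟨a i, ha i⟩) hj

theorem gens {𝒜 : ℕ → Submodule k R}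
    {ℳ : ℤ → Submodule k M} (hfin : ∀ j, FiniteDimensional k (ℳ j))
    (hb : ∃ b, ∀ j < b, ℳ j = ⊥) (d : ℤ) :
    ∃ (n : ℕ) (dg : Fin n → ℤ), (∀ i, dg i ≤ d) ∧ ∀ L : Submodule Rᵐᵒᵖ M,
      GenLE k R M ℳ L d → ∃ a : Fin n → M, (∀ i, a i ∈ ℳ (dg i)) ∧
        Submodule.span Rᵐᵒᵖ (Set.range a) = L := by
  obtain ⟨b, hb⟩ := hb
  let T := Σ j : Finset.Icc b d, Fin (Module.finrank k (ℳ j.1))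
  let e : T ≃ Fin (Fintype.card T) := Fintype.equivFin T
  refine ⟨Fintype.card T, fun i => (e.symm i).1.1, fun i =>
    (Finset.mem_Icc.mp (e.symm i).1.2).2, fun L hL => ?_⟩
  have key : ∀ j : ℤ, ∃ f : Fin (Module.finrank k (ℳ j)) → M,
      (∀ l, f l ∈ ℳ j ∧ f l ∈ L) ∧ ∀ x ∈ ℳ j, x ∈ L → x ∈ Submodule.span k (Set.range f) := by
    intro j
    have := hfin j
    let U := ℳ j ⊓ L.restrictScalars k
    obtain ⟨p, hp⟩ := LinearMap.exists_leftInverse_of_injective U.subtype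
      (Submodule.ker_subtype _)
    let B := Module.finBasis k (ℳ j)
    refine ⟨fun l => (p (B l)).1, fun l => ⟨(p (B l)).2.1, (p (B l)).2.2⟩, fun x hx hxL => ?_⟩
    have h1 : (p x).1 = x := by
      have := LinearMap.congr_fun hp ⟨x, hx, hxL⟩
      exact congr_arg Subtype.val this
    have h2 := B.sum_repr ⟨x, hx⟩
    have h3 : x = (∑ i, (B.repr ⟨x, hx⟩) i • B i : ℳ j).1 := (congr_arg Subtype.val h2).symm
    rw [← h1, h3]
    generalize B.repr ⟨x, hx⟩ = c
    simp only [AddSubmonoidClass.coe_finset_sum, map_sum, Submodule.coe_smul, map_smul]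
    exact Submodule.sum_mem _ fun l _ => Submodule.smul_mem _ _ (Submodule.subset_span ⟨l, rfl⟩)
  choose f hf1 hf2 using key
  let F : T → M := fun t => f t.1.1 t.2
  refine ⟨fun i => F (e.symm i), fun i => (hf1 _ _).1, le_antisymm ?_ (hL.trans ?_)⟩
  · rw [Submodule.span_le]
    rintro _ ⟨i, rfl⟩
    exact (hf1 _ _).2
  · rw [Submodule.span_le]
    rintro x ⟨hxL, j, hj, hx⟩
    rcases lt_or_ge j b with hjb | hjb
    · rw [hb j hjb] at hx
      rw [(Submodule.mem_bot k).mp hx]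
      exact Submodule.zero_mem _
    · have h1 := hf2 j x hx hxL
      have h2 : Submodule.span k (Set.range (f j)) ≤ (Submodule.span Rᵐᵒᵖ
          (Set.range fun i => F (e.symm i))).restrictScalars k := by
        rw [Submodule.span_le]
        rintro _ ⟨l, rfl⟩
        refine Submodule.subset_span ⟨e ⟨⟨j, Finset.mem_Icc.mpr ⟨hjb, hj⟩⟩, l⟩, ?_⟩
        simp only [Equiv.symm_apply_apply, F]
      exact h2 h1

/-- effective coherence, integer version -/
def EC (𝒜 : ℕ → Submodule k R) (ℳ : ℤ → Submodule k M) : Prop :=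
  ∀ d : ℤ, ∃ D : ℤ, ∀ (n : ℕ) (a : Fin n → M) (dg : Fin n → ℤ),
    (∀ i, a i ∈ ℳ (dg i)) → (∀ i, dg i ≤ d) → SolGenLE k R M 𝒜 a dg D

theorem main_fin {𝒜 : ℕ → Submodule k R} (hc : IsConnAlg k R 𝒜) (hlf : LocFin k R 𝒜)
    {ℳ : ℤ → Submodule k M} (hM : GM 𝒜 ℳ) (hfin : ∀ j, FiniteDimensional k (ℳ j))
    (hb : ∃ b, ∀ j < b, ℳ j = ⊥) (hEC : EC 𝒜 ℳ) : EffForSeries k R M ℳ := by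
  intro d
  obtain ⟨n, dg, hdg, hgen⟩ := gens (𝒜 := 𝒜) hfin hb d
  obtain ⟨D, hD⟩ := hEC d
  obtain ⟨n', dg', hdg', hgen'⟩ := gens (𝒜 := 𝒜) (FreeGr_fin hlf dg) (FreeGr_bdd 𝒜 dg) D
  let g : ℤ → ℕ := fun j => Module.finrank k (FreeGr 𝒜 dg j)
  by_contra hinf
  have hcomp : IsCompact (Set.pi Set.univ (fun j : ℤ => Set.Iic (g j))) :=
    isCompact_univ_pi fun j => (Set.finite_Iic _).isCompact
  obtain ⟨h, hbox, hacc⟩ := Set.Infinite.exists_accPt_of_subset_isCompact hinf hcomp (by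
    rintro _ ⟨L, hL, rfl⟩ j -
    obtain ⟨a, ha, rfl⟩ := hgen L hL
    have := hilb_add hc hlf hM ha j
    simp only [Set.mem_Iic, g]
    omega)
  obtain ⟨N1, hN1⟩ := lemmaA hc hM hfin dg h
  obtain ⟨N2, hN2⟩ := lemmaA hc (FreeGr_GM hc dg) (FreeGr_fin hlf dg) dg' (fun j => g j - h j)
  rw [accPt_iff_nhds] at hacc
  classical
  have hU : {f : ℤ → ℕ | ∀ j ∈ N1 ∪ N2, f j = h j} ∈ nhds h := by
    have : {f : ℤ → ℕ | ∀ j ∈ N1 ∪ N2, f j = h j} =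
        Set.pi (↑(N1 ∪ N2) : Set ℤ) (fun j => {h j}) := by
      ext f; simp [Set.mem_pi]
    rw [this]
    exact set_pi_mem_nhds (Finset.finite_toSet _) fun j _ => by simp
  obtain ⟨_, ⟨hf, L, hL, rfl⟩, hne⟩ := hacc _ hU
  apply hne
  obtain ⟨a, ha, rfl⟩ := hgen L hL
  have hK : GenLE k R (Fin n → R) (FreeGr 𝒜 dg) (LinearMap.ker (Phi a)) D := by
    intro v hv
    have := hD n a dg ha hdg v hv
    simp only [← mem_FreeGr, ← mem_ker_Phi] at this
    exact this
  obtain ⟨a', ha', hspan⟩ := hgen' _ hK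
  have hsum := hilb_add hc hlf hM ha
  have h1 := hN1 a ha (fun j hj => (hf j (Finset.mem_union_left _ hj)).le)
  have h2 := hN2 a' ha' (fun j hj => by
    have := hf j (Finset.mem_union_right _ hj)
    have := hsum j
    rw [hspan]
    simp only [g]
    omega)
  rw [hspan] at h2
  ext j
  have a1 := h1 j
  have a2 := h2 j
  have a3 := hsum j
  have a4 := hbox j trivial
  simp only [Set.mem_Iic, g] at a2 a4
  omega

end aux

section aux2

variable {k : Type} [Field k] {R : Type} [Ring R] [Algebra k R]
variable {M : Type} [AddCommGroup M] [Module Rᵐᵒᵖ M] [Module k M]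

theorem EC_alg {𝒜 : ℕ → Submodule k R} (hec : EffCohAlg k R 𝒜) :
    EC (M := R) 𝒜 (grZ k R 𝒜) := by
  obtain ⟨D, -, hD⟩ := hec
  exact fun d => ⟨D d.toNat, fun n a dg ha hdg => hD d.toNat n a dg ha
    (fun i => by have := hdg i; omega)⟩

theorem Phi_comp {n m : ℕ} (a : Fin n → M) (g : Fin m → Fin n → R) (y : Fin m → R) :
    Phi a (Phi g y) = Phi (fun l => Phi a (g l)) y := by
  rw [Phi_apply g, Phi_apply (fun l => Phi a (g l)), map_sum]
  simp only [map_smul]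

theorem EC_free_aux {𝒜 : ℕ → Submodule k R} (hc : IsConnAlg k R 𝒜)
    (hR : EC (M := R) 𝒜 (grZ k R 𝒜)) {t : ℕ} (db : Fin t → ℤ) (s : Finset (Fin t)) :
    ∀ d : ℤ, ∃ D : ℤ, ∀ (n : ℕ) (a : Fin n → Fin t → R) (dg : Fin n → ℤ),
      (∀ i, FreeHomog k R 𝒜 db (a i) (dg i)) → (∀ i, dg i ≤ d) →
      ∀ v : Fin n → R, (∀ c ∈ s, Phi (fun i => a i c) v = 0) →
      v ∈ Submodule.span Rᵐᵒᵖ {w : Fin n → R | (∀ c ∈ s, Phi (fun i => a i c) w = 0) ∧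
        ∃ j ≤ D, FreeHomog k R 𝒜 dg w j} := by
  classical
  induction s using Finset.induction_on with
  | empty =>
    intro d
    refine ⟨d, fun n a dg ha hdg v _ => ?_⟩
    have hv : v = ∑ i, op (v i) • (Pi.single i 1 : Fin n → R) := by
      ext l
      simp [Finset.sum_apply, Pi.single_apply]
    rw [hv]
    refine Submodule.sum_mem _ fun i _ => Submodule.smul_mem _ _ (Submodule.subset_span
      ⟨by simp, dg i, hdg i, fun l => ?_⟩)
    by_cases hl : l = i
    · subst hl
      simpa using one_mem_grZ hc
    · simp [hl]
  | insert c s _ ih =>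
    intro d
    obtain ⟨D1, hD1⟩ := ih d
    obtain ⟨D2, hD2⟩ := hR (D1 - db c)
    refine ⟨D2 + db c, fun n a dg ha hdg v hv => ?_⟩
    have hv1 := hD1 n a dg ha hdg v (fun c' hc' => hv c' (Finset.mem_insert_of_mem hc'))
    rw [Submodule.mem_span_set'] at hv1
    obtain ⟨m, y, g, hy⟩ := hv1
    choose j hj hjh using fun l => (g l).2.2
    have hvy : v = Phi (fun l => (g l).1) (fun l => unop (y l)) := by
      rw [← hy, Phi_apply]
      simp
    have hy2 := hD2 m (fun l => Phi (fun i => a i c) (g l).1) (fun l => j l - db c)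
      (fun l => by
        rw [Phi_apply]
        exact Submodule.sum_mem _ fun i _ => grZ_mul (l := j l - db c) hc (ha i c) (hjh l i) (by omega))
      (fun l => by have := hj l; omega) (fun l => unop (y l)) (by
        have := hv c (Finset.mem_insert_self _ _)
        rw [hvy, Phi_comp] at this
        exact this)
    have hmem := Submodule.mem_map_of_mem (f := Phi (fun l => (g l).1)) hy2
    rw [← hvy, Submodule.map_span] at hmem
    refine Submodule.span_mono ?_ hmem
    rintro _ ⟨w, ⟨hw, q, hq, hwq⟩, rfl⟩
    refine ⟨fun c' hc' => ?_, q + db c, by omega, ?_⟩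
    · rw [Phi_comp]
      rcases Finset.mem_insert.mp hc' with rfl | hc'
      · exact hw
      · have : (fun l => Phi (fun i => a i c') (g l).1) = fun _ => 0 := by
          ext l
          exact (g l).2.1 c' hc'
        rw [this, Phi_apply]
        simp
    · rw [← mem_FreeGr]
      refine Phi_mem (FreeGr_GM hc dg) (dg := j) (fun l => mem_FreeGr.mpr (hjh l)) fun l => ?_
      have := hwq l
      convert this using 1
      congr 1
      ring

theorem EC_free {𝒜 : ℕ → Submodule k R} (hc : IsConnAlg k R 𝒜)
    (hR : EC (M := R) 𝒜 (grZ k R 𝒜)) {t : ℕ} (db : Fin t → ℤ) :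
    EC 𝒜 (FreeGr 𝒜 db) := by
  intro d
  obtain ⟨D, hD⟩ := EC_free_aux hc hR db Finset.univ d
  refine ⟨D, fun n a dg ha hdg v hv => ?_⟩
  have hiff : ∀ w : Fin n → R, IsSol R (Fin t → R) a w ↔
      ∀ c ∈ Finset.univ, Phi (fun i => a i c) w = 0 := by
    intro w
    constructor
    · intro h c _
      have := congr_fun h c
      rw [Finset.sum_apply] at this
      exact this
    · intro h
      ext c
      rw [Finset.sum_apply]
      exact h c (Finset.mem_univ _)
  simp only [hiff] at hv ⊢
  exact hD n a dg (fun i => mem_FreeGr.mp (ha i)) hdg v hv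

variable [IsScalarTower k Rᵐᵒᵖ M]

theorem EC_fp {𝒜 : ℕ → Submodule k R} (hc : IsConnAlg k R 𝒜)
    (hR : EC (M := R) 𝒜 (grZ k R 𝒜)) {ℳ : ℤ → Submodule k M} (hM : GM 𝒜 ℳ)
    (hfp : ModFinPres k R M 𝒜 ℳ) : EC 𝒜 ℳ := by
  obtain ⟨t, b, db, hb, hspan, m, h, e, he, hsol, hgen⟩ := hfp
  intro d
  obtain ⟨E, hE⟩ := (Set.finite_range e).bddAbove
  obtain ⟨D, hD⟩ := EC_free hc hR db (max d E)
  refine ⟨D, fun n a dg ha hdg v hv => ?_⟩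
  have hlift : ∀ i, ∃ x, FreeHomog k R 𝒜 db x (dg i) ∧ Phi b x = a i := by
    intro i
    have h1 : a i ∈ ℳ (dg i) ⊓ (Submodule.span Rᵐᵒᵖ (Set.range b)).restrictScalars k := by
      refine ⟨ha i, ?_⟩
      rw [hspan]; trivial
    rw [desc hc hM hb] at h1
    obtain ⟨x, hx, hxa⟩ := h1
    exact ⟨x, mem_FreeGr.mp hx, hxa⟩
  choose a' ha' hba using hlift
  have hcomp : ∀ w : Fin n → R, Phi a w = Phi b (Phi a' w) := by
    intro w
    rw [Phi_comp]
    simp only [hba]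
  have happ : ∀ w : Fin (n + m) → R, Phi (Fin.append a' h) w =
      Phi a' (fun i => w (Fin.castAdd m i)) + Phi h (fun i => w (Fin.natAdd n i)) := by
    intro w
    simp only [Phi_apply, Fin.sum_univ_add, Fin.append_left, Fin.append_right]
  have hv2 : Phi a' v ∈ Submodule.span Rᵐᵒᵖ (Set.range h) := by
    apply hgen
    have : Phi a v = 0 := hv
    rw [hcomp] at this
    exact this
  rw [← range_Phi] at hv2
  obtain ⟨y, hy⟩ := hv2
  have hmem := hD (n + m) (Fin.append a' h) (Fin.append dg e)
    (fun i => by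
      refine Fin.addCases (fun i => ?_) (fun i => ?_) i
      · rw [Fin.append_left, Fin.append_left]; exact mem_FreeGr.mpr (ha' i)
      · rw [Fin.append_right, Fin.append_right]; exact mem_FreeGr.mpr (he i))
    (fun i => by
      refine Fin.addCases (fun i => ?_) (fun i => ?_) i
      · rw [Fin.append_left]; exact (hdg i).trans (le_max_left _ _)
      · rw [Fin.append_right]; exact (hE ⟨i, rfl⟩).trans (le_max_right _ _))
    (Fin.append v (-y)) (by
      change Phi (Fin.append a' h) _ = 0
      rw [happ]
      simp only [Fin.append_left, Fin.append_right]
      have : (fun i => (-y) i) = -y := rfl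
      rw [this, map_neg, hy]
      exact add_neg_cancel _)
  have hmem2 := Submodule.mem_map_of_mem
    (f := LinearMap.funLeft Rᵐᵒᵖ R (Fin.castAdd m : Fin n → Fin (n + m))) hmem
  rw [Submodule.map_span] at hmem2
  have hpr : LinearMap.funLeft Rᵐᵒᵖ R (Fin.castAdd m : Fin n → Fin (n + m))
      (Fin.append v (-y)) = v := by
    ext i
    simp [LinearMap.funLeft_apply]
  rw [hpr] at hmem2
  refine Submodule.span_mono ?_ hmem2
  rintro _ ⟨w, ⟨hw, q, hq, hwq⟩, rfl⟩
  refine ⟨?_, q, hq, fun i => ?_⟩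
  · change Phi a _ = 0
    have hw' : Phi (Fin.append a' h) w = 0 := hw
    rw [happ] at hw'
    have h1 : LinearMap.funLeft Rᵐᵒᵖ R (Fin.castAdd m : Fin n → Fin (n + m)) w =
      fun i => w (Fin.castAdd m i) := rfl
    rw [hcomp, h1, eq_neg_of_add_eq_zero_left hw', map_neg, Phi_comp]
    have : (fun l => Phi b (h l)) = fun _ => (0 : M) := by
      ext l
      exact hsol l
    rw [this, Phi_apply]
    simp
  · have := hwq (Fin.castAdd m i)
    rw [Fin.append_left] at this
    exact this

theorem fp_fin {𝒜 : ℕ → Submodule k R} (hc : IsConnAlg k R 𝒜) (hlf : LocFin k R 𝒜)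
    {ℳ : ℤ → Submodule k M} (hM : GM 𝒜 ℳ)
    (hfp : ModFinPres k R M 𝒜 ℳ) :
    (∀ j, FiniteDimensional k (ℳ j)) ∧ ∃ b, ∀ j < b, ℳ j = ⊥ := by
  obtain ⟨t, b, db, hb, hspan, -⟩ := hfp
  have key : ∀ j, ℳ j = (FreeGr 𝒜 db j).map ((Phi b).restrictScalars k) := by
    intro j
    rw [← desc hc hM hb, hspan]
    simp
  constructor
  · intro j
    rw [key]
    have := FreeGr_fin hlf db j
    infer_instance
  · obtain ⟨c, hc⟩ := FreeGr_bdd 𝒜 db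
    refine ⟨c, fun j hj => ?_⟩
    rw [key, hc j hj, Submodule.map_bot]

end aux2

/-- every finitely presented graded module over an effectively coherent
algebra is effective for series; in particular, for every `d` the set of Hilbert
series of right ideals generated in degrees at most `d` is finite. -/
theorem statement_11 (k R : Type) [Field k] [Ring R] [Algebra k R]
    (𝒜 : ℕ → Submodule k R) (hconn : IsConnAlg k R 𝒜) (hlf : LocFin k R 𝒜)
    (hfga : FinGenAlg k R) (hec : EffCohAlg k R 𝒜) :
    (∀ P : ModData k R, IsGradedMod k R P.carrier 𝒜 P.grading →
      ModFinPres k R P.carrier 𝒜 P.grading →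
      EffForSeries k R P.carrier P.grading) ∧
    (∀ d : ℕ, {h : ℕ → ℕ | ∃ I : Submodule Rᵐᵒᵖ R,
      GenLE k R R (grZ k R 𝒜) I (d : ℤ) ∧ h = hilbI k R 𝒜 I}.Finite) := by
  have hR := EC_alg hec
  constructor
  · intro P hP hfp
    have hM := mod_GM hP
    obtain ⟨h1, h2⟩ := fp_fin hconn hlf hM hfp
    exact main_fin hconn hlf hM h1 h2 (EC_fp hconn hR hM hfp)
  · intro d
    have := main_fin hconn hlf (grZ_GM hconn) (grZ_fin hlf)
      ⟨0, fun j hj => grZ_neg 𝒜 hj⟩ hR (d : ℤ)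
    refine (this.image (fun h (j : ℕ) => h (j : ℤ))).subset ?_
    rintro _ ⟨I, hI, rfl⟩
    refine ⟨_, ⟨I, hI, rfl⟩, ?_⟩
    ext j
    simp only [hilb, hilbI]
    rw [grZ_natCast]


end NCG
end

section
/- Let k be an algebraically closed field and R a connected finitely generated locally finite graded k-algebra that is right strongly Noetherian, i.e., R ⊗_k C is right Noetherian for every commutative Noetherian k-algebra C. Then R is right Noetherian and effectively coherent (i.e., R is effectively Noetherian). -/
open MulOpposite

namespace NCG

variable (k : Type) [Field k] (R : Type) [Ring R] [Algebra k R]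

variable (M : Type) [AddCommGroup M] [Module Rᵐᵒᵖ M] [Module k M]

section PartOne
open Cardinal PowerSeries

theorem algInd_shift {k A σ : Type} [Field k] [CommRing A] [Algebra k A] (z : σ → A)
    (hz : AlgebraicIndependent k z) (c : σ → k) :
    AlgebraicIndependent k (fun i => z i + algebraMap k A (c i)) := by
  have h : MvPolynomial.aeval (R := k) (fun i => z i + algebraMap k A (c i)) =
      (MvPolynomial.aeval z).comp
        (MvPolynomial.aeval (fun i => MvPolynomial.X i + MvPolynomial.C (c i))) := by
    ext i
    simp [MvPolynomial.algebraMap_eq]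
  have h2 : (MvPolynomial.aeval (R := k) (fun i : σ => MvPolynomial.X i - MvPolynomial.C (c i))).comp
      (MvPolynomial.aeval (R := k) (fun i : σ => MvPolynomial.X i + MvPolynomial.C (c i))) =
      AlgHom.id k (MvPolynomial σ k) := by
    ext i
    simp [MvPolynomial.algebraMap_eq]
  unfold AlgebraicIndependent
  rw [h, AlgHom.coe_comp]
  refine Function.Injective.comp (g := MvPolynomial.aeval z) hz ?_
  refine Function.LeftInverse.injective (g := MvPolynomial.aeval (R := k) (fun i : σ => MvPolynomial.X i - MvPolynomial.C (c i))) ?_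
  intro x
  have := DFunLike.congr_fun h2 x
  simpa using this

/-- algebraic independence of power series over a subfield persists over the field. -/
theorem algInd_map {F k σ : Type} [Field F] [Field k] [Algebra F k] (z : σ → F⟦X⟧)
    (hz : AlgebraicIndependent F z) :
    AlgebraicIndependent k (fun i => PowerSeries.map (algebraMap F k) (z i)) := by
  classical
  rw [algebraicIndependent_iff]
  intro P hP
  by_contra hne
  obtain ⟨m, hm⟩ := MvPolynomial.ne_zero_iff.1 hne
  have hlam : ∃ lam : k →ₗ[F] F, lam (P.coeff m) ≠ 0 := by
    by_contra hcon
    push Not at hcon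
    exact hm ((Module.forall_dual_apply_eq_zero_iff F _).1 hcon)
  obtain ⟨lam, hlam⟩ := hlam
  rw [algebraicIndependent_iff] at hz
  have hQ := hz (∑ d ∈ P.support, MvPolynomial.monomial d (lam (P.coeff d))) ?_
  · apply hlam
    have := congrArg (MvPolynomial.coeff m) hQ
    rw [MvPolynomial.coeff_sum] at this
    simp only [MvPolynomial.coeff_monomial, MvPolynomial.coeff_zero] at this
    rw [Finset.sum_ite_eq' P.support m] at this
    simpa [hm] using this
  · have hP2 : ∑ d ∈ P.support, P.coeff d • PowerSeries.map (algebraMap F k)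
        (d.prod fun i e => z i ^ e) = 0 := by
      rw [← hP]
      conv_rhs => rw [P.as_sum, map_sum]
      refine Finset.sum_congr rfl fun d _ => ?_
      rw [MvPolynomial.aeval_monomial, Algebra.smul_def]
      simp [Finsupp.prod]
    rw [map_sum]
    ext n
    have hn := congrArg (fun f => lam (PowerSeries.coeff n f)) hP2
    simp only [map_sum, map_zero] at hn ⊢
    rw [← hn]
    refine Finset.sum_congr rfl fun d _ => ?_
    rw [MvPolynomial.aeval_monomial, ← Algebra.smul_def]
    simp only [PowerSeries.coeff_smul, PowerSeries.coeff_map, smul_eq_mul]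
    rw [mul_comm (P.coeff d), ← Algebra.smul_def, map_smul, smul_eq_mul, mul_comm]

theorem exists_infinite_basis (F : Type) [Field F] (hF : #F ≤ ℵ₀) :
    ∃ s : Set F⟦X⟧, s.Infinite ∧ PowerSeries.X ∈ s ∧
      AlgebraicIndependent F ((↑) : s → F⟦X⟧) := by
  have hX : AlgebraicIndepOn F id ({PowerSeries.X} : Set F⟦X⟧) := by
    unfold AlgebraicIndepOn
    rw [algebraicIndependent_unique_type_iff]
    rw [transcendental_iff]
    intro p hp
    have h2 : Polynomial.aeval (PowerSeries.X : F⟦X⟧) p = (p : F⟦X⟧) := by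
      have : Polynomial.aeval (PowerSeries.X : F⟦X⟧) = Polynomial.coeToPowerSeries.algHom (R := F) F := by
        ext
        simp [Polynomial.coeToPowerSeries.algHom_apply]
      rw [this, Polynomial.coeToPowerSeries.algHom_apply]
      simp
    have h3 : (p : F⟦X⟧) = 0 := by rw [← h2]; exact hp
    exact_mod_cast h3
  obtain ⟨t, ht, hb⟩ := exists_isTranscendenceBasis_superset hX
  refine ⟨t, ?_, by simpa using ht, hb.1⟩
  intro hfin
  have := hb.isAlgebraic
  have h1 := Algebra.IsAlgebraic.cardinalMk_le_max (Algebra.adjoin F (Set.range (Subtype.val : t → F⟦X⟧))) F⟦X⟧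
  have h2 : #(Algebra.adjoin F (Set.range (Subtype.val : t → F⟦X⟧))) ≤ ℵ₀ := by
    rw [← Cardinal.mk_congr hb.1.aevalEquiv.toEquiv]
    refine MvPolynomial.cardinalMk_le_max.trans ?_
    have : #t ≤ ℵ₀ := (Cardinal.mk_le_aleph0_iff).2 hfin.countable.to_subtype
    simp [hF, this]
  have h3 : #F⟦X⟧ ≤ ℵ₀ := h1.trans (max_le h2 le_rfl)
  have h4 : #(ℕ → Bool) ≤ #F⟦X⟧ := by
    refine Cardinal.mk_le_of_injective (f := fun g => PowerSeries.mk fun n => if g n then (1:F) else 0) ?_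
    intro g g' h
    funext n
    have := congrArg (PowerSeries.coeff n) h
    simp only [PowerSeries.coeff_mk] at this
    cases hg : g n <;> cases hg' : g' n <;> simp_all
  have h5 : ℵ₀ < #(ℕ → Bool) := by
    simp [Cardinal.aleph0_lt_continuum]
  exact absurd (h4.trans h3) (not_le.2 h5)

theorem exists_algInd (k : Type) [Field k] (σ : Type) [Finite σ] (i0 : σ) :
    ∃ z : σ → k⟦X⟧, AlgebraicIndependent k z ∧ z i0 = PowerSeries.X := by
  classical
  have hF : #(Subfield.closure (∅ : Set k)) ≤ ℵ₀ :=
    (Subfield.cardinalMk_closure_le_max _).trans (by simp)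
  obtain ⟨s, hs, hX, hind⟩ := exists_infinite_basis _ hF
  have hs' : (s \ {PowerSeries.X}).Infinite := hs.sdiff (Set.finite_singleton _)
  have : Infinite ↥(s \ {PowerSeries.X}) := hs'.to_subtype
  have := Fintype.ofFinite σ
  obtain ⟨e⟩ : Nonempty (σ ↪ ↥(s \ {PowerSeries.X})) := by
    exact ⟨(Fintype.equivFin σ).toEmbedding.trans (Fin.valEmbedding.trans (Infinite.natEmbedding _))⟩
  let f : σ → s := fun i => if i = i0 then ⟨PowerSeries.X, hX⟩ else ⟨e i, (e i).2.1⟩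
  have hf : Function.Injective f := by
    intro i j hij
    by_cases hi : i = i0 <;> by_cases hj : j = i0 <;> simp only [f, hi, hj, if_true, if_false] at hij
    · rw [hi, hj]
    · exact absurd (congrArg Subtype.val hij).symm (e j).2.2
    · exact absurd (congrArg Subtype.val hij) (e i).2.2
    · exact e.injective (Subtype.ext (Subtype.mk.inj hij))
  refine ⟨_, algInd_map (k := k) _ (hind.comp f hf), ?_⟩
  simp [f]

end PartOne
section PartTwo
open PowerSeries

theorem pid_construction {k L J : Type} [Field k] [Field L] [Algebra k L]
    (φ : J → L →ₐ[k] FractionRing k⟦X⟧) (s : L) (c : J → k) (hc : Function.Injective c)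
    (hs : ∀ l, φ l s = algebraMap k⟦X⟧ _ (PowerSeries.C (c l) + PowerSeries.X))
    (hfin : ∀ f : L, f ≠ 0 →
      {l | ¬ ∃ u : k⟦X⟧, IsUnit u ∧ φ l f = algebraMap k⟦X⟧ _ u}.Finite) :
    ∃ (C : Subalgebra k L) (ε : J → C →ₐ[k] k),
      (∀ f : L, f ∈ C ↔ ∀ l, ∃ u : k⟦X⟧, φ l f = algebraMap k⟦X⟧ _ u) ∧
      IsNoetherianRing C ∧
      (∀ l (f : C) (u : k⟦X⟧), φ l f = algebraMap k⟦X⟧ _ u → ε l f = constantCoeff u) ∧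
      (∀ l, ∃ g : C, ε l g = 0 ∧ ∀ f : C, ε l f = 0 → ∃ f', f = g * f') ∧
      (∀ f : C, f ≠ 0 → {l | ε l f = 0}.Finite) := by
  classical
  have hinj : Function.Injective (algebraMap k⟦X⟧ (FractionRing k⟦X⟧)) :=
    IsFractionRing.injective _ _
  have hkk : ∀ r : k, algebraMap k (FractionRing k⟦X⟧) r =
      algebraMap k⟦X⟧ _ (PowerSeries.C r) := by
    intro r
    rw [IsScalarTower.algebraMap_apply k k⟦X⟧ (FractionRing k⟦X⟧)]
    rfl
  let C : Subalgebra k L :=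
    { carrier := {f | ∀ l, ∃ u : k⟦X⟧, φ l f = algebraMap k⟦X⟧ _ u}
      mul_mem' := by
        intro a b ha hb l
        obtain ⟨u, hu⟩ := ha l
        obtain ⟨v, hv⟩ := hb l
        exact ⟨u * v, by rw [map_mul, map_mul, hu, hv]⟩
      add_mem' := by
        intro a b ha hb l
        obtain ⟨u, hu⟩ := ha l
        obtain ⟨v, hv⟩ := hb l
        exact ⟨u + v, by rw [map_add, map_add, hu, hv]⟩
      algebraMap_mem' := by
        intro r l
        exact ⟨PowerSeries.C r, by rw [AlgHom.commutes, hkk]⟩ }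
  have hmem : ∀ f : L, f ∈ C ↔ ∀ l, ∃ u : k⟦X⟧, φ l f = algebraMap k⟦X⟧ _ u := fun f => Iff.rfl
  choose U hU using fun (f : C) => (hmem f).1 f.2
  have hUu : ∀ (f : C) l u, φ l f = algebraMap k⟦X⟧ _ u → U f l = u := by
    intro f l u h
    apply hinj
    rw [← h, hU]
  let ε : J → C →ₐ[k] k := fun l =>
    { toFun := fun f => constantCoeff (U f l)
      map_one' := by rw [hUu 1 l 1 (by simp)]; simp
      map_zero' := by rw [hUu 0 l 0 (by simp)]; simp
      map_mul' := fun a b => by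
        rw [hUu (a * b) l (U a l * U b l) (by rw [map_mul, ← hU, ← hU]; simp)]; simp
      map_add' := fun a b => by
        rw [hUu (a + b) l (U a l + U b l) (by rw [map_add, ← hU, ← hU]; simp)]; simp
      commutes' := fun r => by
        rw [hUu (algebraMap k C r) l (PowerSeries.C r) (by rw [← hkk]; exact (φ l).commutes r)]
        simp }
  have hε : ∀ l (f : C) (u : k⟦X⟧), φ l f = algebraMap k⟦X⟧ _ u → ε l f = constantCoeff u := by
    intro l f u h
    change constantCoeff (U f l) = _
    rw [hUu f l u h]
  have hunit : ∀ l (f : C), ε l f ≠ 0 → IsUnit (U f l) := by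
    intro l f h
    rw [PowerSeries.isUnit_iff_constantCoeff]
    exact isUnit_iff_ne_zero.2 h
  -- the prime elements
  let gL : J → L := fun l => s - algebraMap k L (c l)
  have hgφ : ∀ l j, φ j (gL l) = algebraMap k⟦X⟧ _ (PowerSeries.C (c j - c l) + PowerSeries.X) := by
    intro l j
    simp only [gL, map_sub, hs, AlgHom.commutes, hkk, map_add]
    ring
  let g : J → C := fun l => ⟨gL l, fun j => ⟨_, hgφ l j⟩⟩
  have hgself : ∀ l, φ l (g l) = algebraMap k⟦X⟧ _ PowerSeries.X := by
    intro l
    have := hgφ l l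
    simpa using this
  have hgne : ∀ l, (g l : L) ≠ 0 := by
    intro l h
    have := hgself l
    rw [h, map_zero] at this
    exact PowerSeries.X_ne_zero (hinj (by rw [← this, map_zero]))
  have hgu : ∀ l j, l ≠ j → ∃ u : k⟦X⟧, IsUnit u ∧ φ j (g l) = algebraMap k⟦X⟧ _ u := by
    intro l j hlj
    refine ⟨_, ?_, hgφ l j⟩
    rw [PowerSeries.isUnit_iff_constantCoeff]
    simp only [map_add, PowerSeries.constantCoeff_C, PowerSeries.constantCoeff_X, add_zero]
    exact isUnit_iff_ne_zero.2 (sub_ne_zero.2 fun h => hlj (hc h).symm)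
  have hker : ∀ l, ∀ f : C, ε l f = 0 → ∃ f', f = g l * f' := by
    intro l f h
    have hd : PowerSeries.X ∣ U f l := PowerSeries.X_dvd_iff.2 h
    obtain ⟨w, hw⟩ := hd
    refine ⟨⟨f / g l, ?_⟩, ?_⟩
    · intro j
      by_cases hlj : l = j
      · subst hlj
        refine ⟨w, ?_⟩
        rw [map_div₀, hU, hgself, hw, map_mul]
        rw [mul_div_cancel_left₀]
        intro h0
        exact PowerSeries.X_ne_zero (hinj (by rw [h0, map_zero]))
      · obtain ⟨u, ⟨u', rfl⟩, hu⟩ := hgu l j hlj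
        refine ⟨U f j * (↑u'⁻¹ : k⟦X⟧), ?_⟩
        rw [map_div₀, hU, hu, map_mul, div_eq_iff, mul_assoc, ← map_mul]
        · simp
        · intro h0
          exact u'.ne_zero (hinj (by rw [h0, map_zero]))
    · ext
      simp only [MulMemClass.coe_mul]
      rw [mul_div_cancel₀ _ (hgne l)]
  have hfinε : ∀ f : C, f ≠ 0 → {l | ε l f = 0}.Finite := by
    intro f hf
    refine (hfin f (by simpa using hf)).subset ?_
    intro l hl hcon
    obtain ⟨u, hu, hφ⟩ := hcon
    rw [Set.mem_ofPred_eq, hε l f u hφ] at hl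
    rw [PowerSeries.isUnit_iff_constantCoeff, hl] at hu
    exact not_isUnit_zero hu
  have hCunit : ∀ f : C, f ≠ 0 → (∀ l, ε l f ≠ 0) → IsUnit f := by
    intro f hf0 h
    refine IsUnit.of_mul_eq_one ⟨(f : L)⁻¹, ?_⟩ ?_
    · intro l
      obtain ⟨u, hu⟩ := hunit l f (h l)
      refine ⟨(↑u⁻¹ : k⟦X⟧), ?_⟩
      rw [map_inv₀, hU, ← hu]
      rw [inv_eq_iff_eq_inv, eq_comm]
      apply inv_eq_of_mul_eq_one_left
      rw [← map_mul]; simp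
    · ext
      simp only [MulMemClass.coe_mul, OneMemClass.coe_one]
      exact mul_inv_cancel₀ (by simpa using hf0)
  -- factorization by induction on a finite sum of orders
  have hfact : ∀ (P : Ideal C), P.IsPrime → ∀ (N : ℕ) (S : Finset J) (f : C), f ≠ 0 → f ∈ P →
      (∀ l, ε l f = 0 → l ∈ S) → ∑ l ∈ S, (U f l).order.toNat < N → ∃ l, g l ∈ P := by
    intro P hP N
    induction N with
    | zero =>
      intro S f hf hfP hS hN
      exact absurd hN (Nat.not_lt_zero _)
    | succ N ih =>
      intro S f hf hfP hS hN
      by_cases hex : ∃ l, ε l f = 0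
      swap
      · push Not at hex
        exact absurd (Ideal.eq_top_of_isUnit_mem _ hfP (hCunit f hf hex)) hP.ne_top
      obtain ⟨l, hl⟩ := hex
      obtain ⟨f', hf'⟩ := hker l f hl
      rcases hP.mem_or_mem (hf' ▸ hfP) with h | h
      · exact ⟨l, h⟩
      have hf'0 : f' ≠ 0 := by
        rintro rfl
        exact hf (by rw [hf', mul_zero])
      have hU0 : ∀ j, U f' j ≠ 0 := by
        intro j h0
        have := hU f' j
        rw [h0, map_zero] at this
        have := (map_eq_zero (φ j)).1 this
        exact hf'0 (by simpa using this)
      have hself : (U f l).order.toNat = (U f' l).order.toNat + 1 := by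
        have : U f l = PowerSeries.X * U f' l := by
          apply hUu
          rw [hf', map_mul, ← hU, ← hgself l, ← map_mul]; rfl
        rw [this, PowerSeries.order_mul, PowerSeries.order_X, ENat.toNat_add (by simp)
          (by simpa using hU0 l)]
        simp [add_comm]
      have hother : ∀ j, l ≠ j → (U f j).order.toNat = (U f' j).order.toNat := by
        intro j hlj
        obtain ⟨u, hu, hφu⟩ := hgu l j hlj
        have : U f j = u * U f' j := by
          apply hUu
          rw [hf', map_mul, ← hU, ← hφu, ← map_mul]; rfl
        rw [this, PowerSeries.order_mul, PowerSeries.order_zero_of_unit hu, zero_add]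
      refine ih S f' hf'0 h ?_ ?_
      · intro j hj
        apply hS
        rw [hf', map_mul, hj, mul_zero]
      · have : ∑ j ∈ S, (U f' j).order.toNat < ∑ j ∈ S, (U f j).order.toNat := by
          apply Finset.sum_lt_sum
          · intro j _
            by_cases hlj : l = j
            · subst hlj; omega
            · rw [hother j hlj]
          · exact ⟨l, hS l hl, by omega⟩
        omega
  refine ⟨C, ε, hmem, ?_, hε, fun l => ⟨g l, by rw [hε l _ _ (hgself l)]; simp, hker l⟩, hfinε⟩
  refine IsNoetherianRing.of_prime fun P hP => ?_
  by_cases hbot : P = ⊥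
  · rw [hbot]; exact Submodule.fg_bot
  obtain ⟨f, hfP, hf0⟩ := Submodule.exists_mem_ne_zero_of_ne_bot hbot
  obtain ⟨l, hl⟩ := hfact P hP _ (hfinε f hf0).toFinset f hf0 hfP (by simp) (Nat.lt_succ_self _)
  have : P = Ideal.span {g l} := by
    apply le_antisymm
    · intro x hx
      by_contra hxn
      have hx0 : ε l x ≠ 0 := by
        intro h
        obtain ⟨f', hf'⟩ := hker l x h
        exact hxn (Ideal.mem_span_singleton.2 ⟨f', hf'⟩)
      -- x - ε x in kernel
      have h1 : ε l (x - algebraMap k C (ε l x)) = 0 := by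
        rw [map_sub, AlgHom.commutes]; simp
      obtain ⟨f', hf'⟩ := hker l _ h1
      have h2 : algebraMap k C (ε l x) ∈ P := by
        have : algebraMap k C (ε l x) = x - g l * f' := by rw [← hf']; ring
        rw [this]
        exact P.sub_mem hx (P.mul_mem_right _ hl)
      exact hP.ne_top (Ideal.eq_top_of_isUnit_mem _ h2 ((isUnit_iff_ne_zero.2 hx0).map (algebraMap k C)))
    · rw [Ideal.span_singleton_le_iff_mem]; exact hl
  rw [this]
  exact ⟨{g l}, by simp⟩

end PartTwo
section PartThree
open PowerSeries

theorem hensel_ps {k : Type} [Field k] (f : Polynomial k⟦X⟧) (hf : f.Monic) (a : k)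
    (h0 : constantCoeff (f.eval (PowerSeries.C a)) = 0)
    (h1 : constantCoeff (f.derivative.eval (PowerSeries.C a)) ≠ 0) :
    ∃ ρ : k⟦X⟧, f.eval ρ = 0 ∧ constantCoeff ρ = a := by
  obtain ⟨ρ, h, h'⟩ := HenselianRing.is_henselian (R := k⟦X⟧)
    (I := Ideal.span {(PowerSeries.X : k⟦X⟧)}) f hf (PowerSeries.C a)
    (Ideal.mem_span_singleton.2 (PowerSeries.X_dvd_iff.2 h0))
    (IsUnit.map _ (PowerSeries.isUnit_iff_constantCoeff.2 (isUnit_iff_ne_zero.2 h1)))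
  refine ⟨ρ, h, ?_⟩
  have := PowerSeries.X_dvd_iff.1 (Ideal.mem_span_singleton.1 h')
  rw [map_sub, PowerSeries.constantCoeff_C, sub_eq_zero] at this
  exact this

theorem prim_core (B K L : Type) [CommRing B] [IsDomain B] [IsIntegrallyClosed B] [Field K]
    [Field L] [Algebra B K] [IsFractionRing B K] [Algebra K L] [Algebra B L]
    [IsScalarTower B K L] [FiniteDimensional K L] [Algebra.IsSeparable K L] :
    ∃ (θ : L) (f : Polynomial B), f.Monic ∧ Polynomial.aeval θ f = 0 ∧
      Polynomial.aeval θ f.derivative ≠ 0 ∧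
      (∀ x : L, ∃ h : B, h ≠ 0 ∧ ∃ G : Polynomial B, algebraMap B L h * x = Polynomial.aeval θ G) ∧
      ∀ (F : Type) [Field F] (ψ : B →+* F), Function.Injective ψ → ∀ ρ : F,
        Polynomial.eval₂ ψ ρ f = 0 →
        ∃ φ : L →+* F, φ.comp (algebraMap B L) = ψ ∧ φ θ = ρ := by
  classical
  obtain ⟨θ0, hθ0⟩ := Field.exists_primitive_element K L
  have hinjBK : Function.Injective (algebraMap B K) := IsFractionRing.injective B K
  have halg : IsAlgebraic B θ0 := (IsFractionRing.isAlgebraic_iff B K L).2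
    (Algebra.IsAlgebraic.isAlgebraic θ0)
  obtain ⟨y, hy, hintg⟩ := halg.exists_integral_multiple
  set θ := y • θ0 with hθ
  have hyK : algebraMap B K y ≠ 0 := by
    rw [Ne, map_eq_zero_iff _ hinjBK]; exact hy
  have htop : IntermediateField.adjoin K {θ} = ⊤ := by
    rw [← top_le_iff, ← hθ0, IntermediateField.adjoin_le_iff, Set.singleton_subset_iff]
    have h1 : θ ∈ IntermediateField.adjoin K {θ} := IntermediateField.mem_adjoin_simple_self K θ
    have h2 := (IntermediateField.adjoin K {θ}).smul_mem h1 (x := (algebraMap B K y)⁻¹)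
    have h3 : (algebraMap B K y)⁻¹ • θ = θ0 := by
      rw [hθ, ← IsScalarTower.algebraMap_smul K y θ0, smul_smul, inv_mul_cancel₀ hyK, one_smul]
    rw [h3] at h2
    exact h2
  have htop' : Algebra.adjoin K {θ} = ⊤ := IntermediateField.adjoin_eq_top_iff.1 htop
  have hmin : minpoly K θ = Polynomial.map (algebraMap B K) (minpoly B θ) :=
    minpoly.isIntegrallyClosed_eq_field_fractions' K hintg
  have hsep : (minpoly K θ).Separable := Algebra.IsSeparable.isSeparable K θ
  refine ⟨θ, minpoly B θ, minpoly.monic hintg, minpoly.aeval B θ, ?_, ?_, ?_⟩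
  · have := hsep.aeval_derivative_ne_zero (minpoly.aeval K θ)
    rwa [hmin, Polynomial.derivative_map, Polynomial.aeval_map_algebraMap] at this
  · intro x
    have hx : x ∈ Algebra.adjoin K {θ} := by rw [htop']; trivial
    rw [Algebra.adjoin_singleton_eq_range_aeval] at hx
    obtain ⟨p, hp⟩ := hx
    obtain ⟨b, hbm, hb⟩ := IsLocalization.integerNormalization_spec (nonZeroDivisors B) p
    refine ⟨b, nonZeroDivisors.ne_zero hbm, IsLocalization.integerNormalization (nonZeroDivisors B) p, ?_⟩
    rw [← Polynomial.aeval_map_algebraMap K, hb, ← hp]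
    change _ = Polynomial.aeval θ ((b : B) • p)
    rw [← IsScalarTower.algebraMap_smul K (b : B) p, map_smul, Algebra.smul_def, ← IsScalarTower.algebraMap_apply]
    rfl
  · intro F _ ψ hψ ρ hρ
    let ψK : K →+* F := IsFractionRing.lift hψ
    have hψK : ψK.comp (algebraMap B K) = ψ := by
      ext b
      exact IsFractionRing.lift_algebraMap hψ b
    let : Algebra K F := ψK.toAlgebra
    let pb := PowerBasis.ofAdjoinEqTop (Algebra.IsIntegral.isIntegral (R := K) θ) htop'
    have hgen : pb.gen = θ := PowerBasis.ofAdjoinEqTop_gen _ _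
    have hroot : Polynomial.aeval ρ (minpoly K pb.gen) = 0 := by
      rw [hgen, hmin, Polynomial.aeval_def, Polynomial.eval₂_map]
      change Polynomial.eval₂ (ψK.comp _) _ _ = _
      rw [hψK]; exact hρ
    refine ⟨(pb.lift ρ hroot).toRingHom, ?_, ?_⟩
    · ext b
      rw [IsScalarTower.algebraMap_eq B K L]
      have := (pb.lift ρ hroot).commutes (algebraMap B K b)
      simp only [RingHom.comp_apply]
      rw [← hψK]
      exact this
    · have := pb.lift_gen ρ hroot
      rw [hgen] at this
      exact this

theorem fun_field (k L : Type) [Field k] [PerfectField k] [Field L] [Algebra k L]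
    [Algebra.EssFiniteType k L] (hna : ¬ Algebra.IsAlgebraic k L) :
    ∃ (σ : Type) (_ : Finite σ) (_ : σ) (y : σ → L) (θ : L) (f : Polynomial (MvPolynomial σ k)),
      f.Monic ∧ f.eval₂ (MvPolynomial.aeval y).toRingHom θ = 0 ∧
      f.derivative.eval₂ (MvPolynomial.aeval y).toRingHom θ ≠ 0 ∧
      (∀ x : L, ∃ h : MvPolynomial σ k, MvPolynomial.aeval y h ≠ 0 ∧
        ∃ G : Polynomial (MvPolynomial σ k),
        MvPolynomial.aeval y h * x = G.eval₂ (MvPolynomial.aeval y).toRingHom θ) ∧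
      ∀ (F : Type) [Field F] (ψ : MvPolynomial σ k →+* F), Function.Injective ψ → ∀ ρ : F,
        Polynomial.eval₂ ψ ρ f = 0 →
        ∃ φ : L →+* F, φ.comp (MvPolynomial.aeval y).toRingHom = ψ ∧ φ θ = ρ := by
  classical
  obtain ⟨s, hs, hsep⟩ := exists_isTranscendenceBasis_and_isSeparable_of_perfectField k L
  have hne : Nonempty s := by
    by_contra hem
    rw [not_nonempty_iff] at hem
    exact hna (hs.isEmpty_iff_isAlgebraic.1 hem)
  let y : s → L := fun i => (i : L)
  have hy : AlgebraicIndependent k y := hs.1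
  have hrange : Set.range y = (s : Set L) := by
    ext x; simp [y]
  rw [← hrange] at hsep
  let B := MvPolynomial s k
  let K := IntermediateField.adjoin k (Set.range y)
  let e := hy.aevalEquivField
  let : Algebra B K := (e.toRingEquiv.toRingHom.comp (algebraMap B (FractionRing B))).toAlgebra
  let : Algebra B L := (MvPolynomial.aeval y).toRingHom.toAlgebra
  have : IsScalarTower B K L := IsScalarTower.of_algebraMap_eq' (by
    refine RingHom.ext fun b => ?_
    exact (hy.aevalEquivField_algebraMap_apply_coe b).symm)
  let e' : FractionRing B ≃ₐ[B] K := AlgEquiv.ofRingEquiv (f := e.toRingEquiv) (fun b => rfl)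
  have : IsFractionRing B K := IsLocalization.isLocalization_of_algEquiv (nonZeroDivisors B) e'
  have : Algebra.IsSeparable K L := hsep
  have : Algebra.EssFiniteType K L := Algebra.EssFiniteType.of_comp k K L
  have : FiniteDimensional K L := Algebra.finite_of_essFiniteType_of_isAlgebraic
  obtain ⟨θ, f, h1, h2, h3, h4, h5⟩ := prim_core B K L
  refine ⟨s, inferInstance, hne.some, y, θ, f, h1, h2, h3, ?_, ?_⟩
  · intro x
    obtain ⟨h, hh, G, hG⟩ := h4 x
    refine ⟨h, ?_, G, hG⟩
    rwa [Ne, map_eq_zero_iff _ hy]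
  · exact h5

end PartThree
section PartThreeB
open PowerSeries

theorem hensel_point (k L : Type) [Field k] [PerfectField k] [Field L] [Algebra k L]
    [Algebra.EssFiniteType k L] (hna : ¬ Algebra.IsAlgebraic k L) (T : Finset L) :
    ∃ (E : Set L) (s : L), E.Finite ∧ ∀ (O : Subalgebra k L), E ⊆ O → ∀ p : O →ₐ[k] k,
      ∃ φ : L →ₐ[k] FractionRing k⟦X⟧,
        (∃ c : k, φ s = algebraMap k⟦X⟧ _ (PowerSeries.C c + PowerSeries.X)) ∧
        ∀ t ∈ T, ∀ hO : t ∈ O, ∃ u : k⟦X⟧, φ t = algebraMap k⟦X⟧ _ u ∧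
          constantCoeff u = p ⟨t, hO⟩ := by
  classical
  obtain ⟨σ, hσ, i0, y, θ, f, hf, hf0, hf1, hden, hext⟩ := fun_field k L hna
  choose h hh G hG using hden
  obtain ⟨z, hz, hz0⟩ := exists_algInd k σ i0
  have hinj : Function.Injective (algebraMap k⟦X⟧ (FractionRing k⟦X⟧)) :=
    IsFractionRing.injective _ _
  refine ⟨Set.range y ∪ {θ, (f.derivative.eval₂ (MvPolynomial.aeval y).toRingHom θ)⁻¹} ∪
    (fun t => (MvPolynomial.aeval y (h t))⁻¹) '' (T : Set L), y i0, ?_, ?_⟩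
  · exact ((Set.finite_range y).union (by simp)).union (T.finite_toSet.image _)
  intro O hE p
  have hy : ∀ i, y i ∈ O := fun i => hE (Or.inl (Or.inl ⟨i, rfl⟩))
  have hθ : θ ∈ O := hE (Or.inl (Or.inr (by simp)))
  have hw : (f.derivative.eval₂ (MvPolynomial.aeval y).toRingHom θ)⁻¹ ∈ O :=
    hE (Or.inl (Or.inr (by simp)))
  have hhinv : ∀ t ∈ T, (MvPolynomial.aeval y (h t))⁻¹ ∈ O :=
    fun t ht => hE (Or.inr ⟨t, ht, rfl⟩)
  let yO : σ → O := fun i => ⟨y i, hy i⟩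
  let θO : O := ⟨θ, hθ⟩
  let aO : MvPolynomial σ k →ₐ[k] O := MvPolynomial.aeval yO
  have haO : O.val.comp aO = MvPolynomial.aeval y := by
    apply MvPolynomial.algHom_ext
    intro i
    simp [aO, yO]
  have haO' : ∀ b, ((aO b : O) : L) = MvPolynomial.aeval y b := fun b => DFunLike.congr_fun haO b
  let ζ : σ → k⟦X⟧ := fun i => z i + algebraMap k k⟦X⟧ (p (yO i) - constantCoeff (z i))
  have hζ : AlgebraicIndependent k ζ := algInd_shift z hz _
  have halgC : ∀ c : k, algebraMap k k⟦X⟧ c = PowerSeries.C c := fun c => rfl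
  have hζc : ∀ i, constantCoeff (ζ i) = p (yO i) := by
    intro i
    simp [ζ, halgC]
  let ψ : MvPolynomial σ k →ₐ[k] k⟦X⟧ := MvPolynomial.aeval ζ
  have hψc : (constantCoeff (R := k)).comp ψ.toRingHom = p.toRingHom.comp aO.toRingHom := by
    apply MvPolynomial.ringHom_ext
    · intro r
      have e1 : ψ (MvPolynomial.C r) = PowerSeries.C r := ψ.commutes r
      have e2 : aO (MvPolynomial.C r) = algebraMap k O r := aO.commutes r
      change constantCoeff (ψ (MvPolynomial.C r)) = p (aO (MvPolynomial.C r))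
      rw [e1, e2, p.commutes]; simp
    · intro i
      change constantCoeff (ψ (MvPolynomial.X i)) = p (aO (MvPolynomial.X i))
      simp only [ψ, aO, MvPolynomial.aeval_X, hζc]
  have hψc' : ∀ b, constantCoeff (ψ b) = p (aO b) := fun b => DFunLike.congr_fun hψc b
  have key : ∀ (Q : Polynomial (MvPolynomial σ k)) (ρ : k⟦X⟧), constantCoeff ρ = p θO →
      constantCoeff (Q.eval₂ ψ.toRingHom ρ) = p (Q.eval₂ aO.toRingHom θO) := by
    intro Q ρ hρ
    rw [Polynomial.hom_eval₂, hψc, hρ]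
    exact (Polynomial.hom_eval₂ Q aO.toRingHom p.toRingHom θO).symm
  have key2 : ∀ (Q : Polynomial (MvPolynomial σ k)),
      ((Q.eval₂ aO.toRingHom θO : O) : L) = Q.eval₂ (MvPolynomial.aeval y).toRingHom θ := by
    intro Q
    have := Polynomial.hom_eval₂ Q aO.toRingHom O.val.toRingHom θO
    have h2 : O.val.toRingHom.comp aO.toRingHom = (MvPolynomial.aeval y).toRingHom := by
      rw [← haO]; rfl
    rw [h2] at this
    exact this
  obtain ⟨ρ, hρ0, hρc⟩ := hensel_ps (f.map ψ.toRingHom) (hf.map _) (p θO)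
    (by
      rw [Polynomial.eval_map, key _ _ (by simp)]
      have : (f.eval₂ aO.toRingHom θO : O) = 0 := by
        apply Subtype.ext
        rw [key2, hf0]; rfl
      rw [this, map_zero])
    (by
      rw [Polynomial.derivative_map, Polynomial.eval_map, key _ _ (by simp)]
      intro h0
      have : (f.derivative.eval₂ aO.toRingHom θO : O) * ⟨_, hw⟩ = 1 := by
        apply Subtype.ext
        change ((f.derivative.eval₂ aO.toRingHom θO : O) : L) * _ = 1
        rw [key2, mul_inv_cancel₀ hf1]
      have := congrArg p this
      rw [map_mul, h0, zero_mul, map_one] at this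
      exact zero_ne_one this)
  rw [Polynomial.eval_map] at hρ0
  obtain ⟨φ, hφ1, hφ2⟩ := hext (FractionRing k⟦X⟧) ((algebraMap k⟦X⟧ _).comp ψ.toRingHom)
    (by
      rw [RingHom.coe_comp]
      exact hinj.comp hζ) (algebraMap k⟦X⟧ _ ρ)
    (by
      rw [← Polynomial.hom_eval₂, hρ0, map_zero])
  have hφ1' : ∀ b, φ (MvPolynomial.aeval y b) = algebraMap k⟦X⟧ _ (ψ b) :=
    fun b => DFunLike.congr_fun hφ1 b
  refine ⟨{ φ with commutes' := ?_ }, ⟨p (yO i0), ?_⟩, ?_⟩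
  · intro r
    have := hφ1' (algebraMap k _ r)
    rw [AlgHom.commutes, AlgHom.commutes] at this
    rw [IsScalarTower.algebraMap_apply k k⟦X⟧ (FractionRing k⟦X⟧)]
    exact this
  · have := hφ1' (MvPolynomial.X i0)
    simp only [ψ, MvPolynomial.aeval_X, ζ, hz0] at this
    change φ (y i0) = _
    rw [this, halgC]
    simp [add_comm]
  · intro t ht hO
    change ∃ u : k⟦X⟧, φ t = algebraMap k⟦X⟧ _ u ∧ _
    have hp : p (aO (h t)) ≠ 0 := by
      intro h0
      have : aO (h t) * ⟨_, hhinv t ht⟩ = 1 := by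
        apply Subtype.ext
        change ((aO (h t) : O) : L) * _ = 1
        rw [haO', mul_inv_cancel₀ (hh t)]
      have := congrArg p this
      rw [map_mul, h0, zero_mul, map_one] at this
      exact zero_ne_one this
    have hu : IsUnit (ψ (h t)) := by
      rw [PowerSeries.isUnit_iff_constantCoeff, hψc']
      exact isUnit_iff_ne_zero.2 hp
    obtain ⟨u, hu⟩ := hu
    have e1 : φ (MvPolynomial.aeval y (h t)) * φ t =
        algebraMap k⟦X⟧ _ ((G t).eval₂ ψ.toRingHom ρ) := by
      rw [← map_mul, hG, Polynomial.hom_eval₂, hφ1, hφ2, Polynomial.hom_eval₂]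
    rw [hφ1', ← hu] at e1
    have e2 : φ t = algebraMap k⟦X⟧ _ (↑u⁻¹ * (G t).eval₂ ψ.toRingHom ρ) := by
      rw [map_mul, ← e1, ← mul_assoc, ← map_mul]; simp
    refine ⟨_, e2, ?_⟩
    have e3 : (u : k⟦X⟧) * (↑u⁻¹ * (G t).eval₂ ψ.toRingHom ρ) = (G t).eval₂ ψ.toRingHom ρ := by
      rw [← mul_assoc]; simp
    have e4 := congrArg constantCoeff e3
    rw [map_mul, hu, hψc', key _ _ hρc] at e4
    have e5 : ((G t).eval₂ aO.toRingHom θO : O) = aO (h t) * ⟨t, hO⟩ := by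
      apply Subtype.ext
      rw [key2, ← hG]
      change _ = ((aO (h t) : O) : L) * t
      rw [haO']
    rw [e5, map_mul p] at e4
    exact mul_left_cancel₀ hp e4

/-- Extending a point over a finite set of extra fractions. -/
theorem extend_point (k A L : Type) [Field k] [CommRing A] [IsDomain A] [Algebra k A] [Field L]
    [Algebra A L] [IsFractionRing A L] [Algebra k L] [IsScalarTower k A L] (E : Set L)
    (hE : E.Finite) :
    ∃ δ : A, δ ≠ 0 ∧ ∀ p : A →ₐ[k] k, p δ ≠ 0 → ∃ (O : Subalgebra k L) (p' : O →ₐ[k] k),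
      E ⊆ O ∧ ∀ a : A, ∃ h : algebraMap A L a ∈ O, p' ⟨_, h⟩ = p a := by
  classical
  obtain ⟨⟨δ, hδ⟩, hintg⟩ := IsLocalization.exist_integer_multiples_of_finset (nonZeroDivisors A)
    hE.toFinset
  have hδ0 : δ ≠ 0 := nonZeroDivisors.ne_zero hδ
  refine ⟨δ, hδ0, fun p hp => ?_⟩
  have hδL : algebraMap A L δ ≠ 0 := by
    rw [Ne, map_eq_zero_iff _ (IsFractionRing.injective A L)]; exact hδ0
  let j : Localization.Away δ →ₐ[A] L := IsLocalization.liftAlgHom (M := Submonoid.powers δ)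
    (f := Algebra.ofId A L) (by
      rintro ⟨_, n, rfl⟩
      change IsUnit (algebraMap A L (δ ^ n))
      rw [map_pow]
      exact (isUnit_iff_ne_zero.2 hδL).pow n)
  let q : Localization.Away δ →ₐ[k] k := IsLocalization.liftAlgHom (M := Submonoid.powers δ)
    (f := p) (by
      rintro ⟨_, n, rfl⟩
      change IsUnit (p (δ ^ n))
      rw [map_pow]
      exact (isUnit_iff_ne_zero.2 hp).pow n)
  have hjinj : Function.Injective j := by
    rw [injective_iff_map_eq_zero]
    intro x hx
    obtain ⟨a, s, rfl⟩ := IsLocalization.exists_mk'_eq (Submonoid.powers δ) x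
    have h1 : IsLocalization.mk' (Localization.Away δ) a s * algebraMap A _ s = algebraMap A _ a :=
      IsLocalization.mk'_spec _ _ _
    have h2 := congrArg j h1
    rw [map_mul, hx, zero_mul, AlgHom.commutes, eq_comm,
      map_eq_zero_iff _ (IsFractionRing.injective A L)] at h2
    rw [h2, IsLocalization.mk'_zero]
  let jk : Localization.Away δ →ₐ[k] L := j.restrictScalars k
  let e : Localization.Away δ ≃ₐ[k] jk.range := AlgEquiv.ofInjective jk hjinj
  have hmem : ∀ a : A, algebraMap A L a ∈ jk.range :=
    fun a => ⟨algebraMap A _ a, j.commutes a⟩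
  refine ⟨jk.range, q.comp e.symm.toAlgHom, ?_, fun a => ⟨hmem a, ?_⟩⟩
  · intro x hx
    obtain ⟨a, ha⟩ := hintg x (by simpa using hx)
    change algebraMap A L a = δ • x at ha
    refine ⟨IsLocalization.mk' (Localization.Away δ) a ⟨δ, Submonoid.mem_powers δ⟩, ?_⟩
    have h1 : IsLocalization.mk' (Localization.Away δ) a (⟨δ, Submonoid.mem_powers δ⟩ : Submonoid.powers δ)
      * algebraMap A _ δ = algebraMap A _ a := IsLocalization.mk'_spec _ _ _
    have h2 := congrArg j h1
    rw [map_mul, AlgHom.commutes, AlgHom.commutes, ha, Algebra.smul_def, mul_comm] at h2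
    exact mul_left_cancel₀ hδL h2
  · have : e.symm ⟨_, hmem a⟩ = algebraMap A _ a := by
      rw [AlgEquiv.symm_apply_eq]
      apply Subtype.ext
      exact (j.commutes a).symm
    change q (e.symm ⟨_, hmem a⟩) = p a
    rw [this]
    exact IsLocalization.lift_eq _ a

end PartThreeB
section PartFour
open PowerSeries

theorem curve_thm (k A : Type) [Field k] [IsAlgClosed k] [CommRing A] [IsDomain A] [Algebra k A]
    [Algebra.FiniteType k A] (p : ℕ → A →ₐ[k] k) (hp : ∀ a : A, a ≠ 0 → {m | p m a = 0}.Finite) :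
    ∃ (C : Type) (_ : CommRing C) (_ : IsDomain C) (_ : Algebra k C) (j : A →ₐ[k] C)
      (J : Type) (_ : Infinite J) (idx : J → ℕ) (ε : J → C →ₐ[k] k),
      IsNoetherianRing C ∧ Function.Injective idx ∧ (∀ l a, ε l (j a) = p (idx l) a) ∧
      (∀ l, ∃ g : C, ε l g = 0 ∧ ∀ f : C, ε l f = 0 → ∃ f', f = g * f') ∧
      (∀ c : C, c ≠ 0 → {l | ε l c = 0}.Finite) := by
  classical
  let L := FractionRing A
  by_cases halg : Algebra.IsAlgebraic k L
  · have hA : Algebra.IsAlgebraic k A :=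
      Algebra.IsAlgebraic.of_injective (IsScalarTower.toAlgHom k A L) (IsFractionRing.injective A L)
    have hAi : Algebra.IsIntegral k A := Algebra.IsAlgebraic.isIntegral
    have hsurj : Function.Surjective (algebraMap k A) :=
      IsAlgClosed.algebraMap_bijective_of_isIntegral.2
    refine ⟨A, inferInstance, inferInstance, inferInstance, AlgHom.id k A, ℕ, inferInstance, id, p,
      Algebra.FiniteType.isNoetherianRing k A, Function.injective_id, fun _ _ => rfl, ?_, hp⟩
    intro l
    refine ⟨0, map_zero _, fun f hf => ⟨0, ?_⟩⟩
    obtain ⟨r, rfl⟩ := hsurj f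
    rw [AlgHom.commutes] at hf
    change r = 0 at hf
    rw [hf]; simp
  have hess : Algebra.EssFiniteType k L := Algebra.EssFiniteType.comp k A L
  obtain ⟨S, hS⟩ := (Algebra.FiniteType.out : (⊤ : Subalgebra k A).FG)
  obtain ⟨E, s, hE, hpt⟩ := hensel_point k L halg (S.image (algebraMap A L))
  obtain ⟨δ, hδ, hδp⟩ := extend_point k A L E hE
  let J0 : Set ℕ := {m | p m δ ≠ 0}
  have hJ0 : J0.Infinite := by
    have := (hp δ hδ).infinite_compl
    exact this
  have hex : ∀ m : J0, ∃ (φ : L →ₐ[k] FractionRing k⟦X⟧) (c : k),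
      φ s = algebraMap k⟦X⟧ _ (PowerSeries.C c + PowerSeries.X) ∧
      ∀ a : A, ∃ u : k⟦X⟧, φ (algebraMap A L a) = algebraMap k⟦X⟧ _ u ∧
        constantCoeff u = p m a := by
    intro m
    obtain ⟨O, p', hEO, hO⟩ := hδp (p m) m.2
    obtain ⟨φ, ⟨c, hc⟩, hT⟩ := hpt O hEO p'
    refine ⟨φ, c, hc, ?_⟩
    intro a
    have ha : a ∈ Algebra.adjoin k (S : Set A) := by rw [hS]; trivial
    induction ha using Algebra.adjoin_induction with
    | mem x hx =>
      obtain ⟨h1, h2⟩ := hO x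
      obtain ⟨u, hu, hu'⟩ := hT (algebraMap A L x) (Finset.mem_image_of_mem _ hx) h1
      exact ⟨u, hu, by rw [hu', h2]⟩
    | algebraMap r =>
      refine ⟨PowerSeries.C r, ?_, by simp⟩
      rw [← IsScalarTower.algebraMap_apply k A L, AlgHom.commutes,
        IsScalarTower.algebraMap_apply k k⟦X⟧ (FractionRing k⟦X⟧)]
      rfl
    | add x y _ _ hx hy =>
      obtain ⟨u, h1, h2⟩ := hx
      obtain ⟨v, h3, h4⟩ := hy
      exact ⟨u + v, by rw [map_add, map_add, map_add, h1, h3], by rw [map_add, map_add, h2, h4]⟩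
    | mul x y _ _ hx hy =>
      obtain ⟨u, h1, h2⟩ := hx
      obtain ⟨v, h3, h4⟩ := hy
      exact ⟨u * v, by rw [map_mul, map_mul, map_mul, h1, h3], by rw [map_mul, map_mul, h2, h4]⟩
  choose φ c hc hφ using hex
  have hinj : Function.Injective (algebraMap k⟦X⟧ (FractionRing k⟦X⟧)) :=
    IsFractionRing.injective _ _
  have hfin : ∀ f : L, f ≠ 0 →
      {l | ¬ ∃ u : k⟦X⟧, IsUnit u ∧ φ l f = algebraMap k⟦X⟧ _ u}.Finite := by
    intro f hf
    obtain ⟨a, b, hb, rfl⟩ := IsFractionRing.div_surjective (A := A) f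
    have hb0 : b ≠ 0 := nonZeroDivisors.ne_zero hb
    have ha0 : a ≠ 0 := by
      rintro rfl
      simp at hf
    have h1 : {l : J0 | p l a = 0}.Finite := (hp a ha0).preimage Subtype.val_injective.injOn
    have h2 : {l : J0 | p l b = 0}.Finite := (hp b hb0).preimage Subtype.val_injective.injOn
    refine (h1.union h2).subset ?_
    intro l hl
    by_contra hcon
    simp only [Set.mem_union, Set.mem_ofPred_eq, not_or] at hcon
    apply hl
    obtain ⟨u, hu, hu'⟩ := hφ l a
    obtain ⟨v, hv, hv'⟩ := hφ l b
    have huu : IsUnit u := PowerSeries.isUnit_iff_constantCoeff.2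
      (isUnit_iff_ne_zero.2 (by rw [hu']; exact hcon.1))
    have hvu : IsUnit v := PowerSeries.isUnit_iff_constantCoeff.2
      (isUnit_iff_ne_zero.2 (by rw [hv']; exact hcon.2))
    obtain ⟨v, rfl⟩ := hvu
    refine ⟨u * ↑v⁻¹, huu.mul v⁻¹.isUnit, ?_⟩
    rw [map_div₀, hu, hv, div_eq_iff, ← map_mul, mul_assoc]
    · simp
    · intro h0
      exact v.ne_zero (hinj (by rw [h0, map_zero]))
  have hs0 : ∀ r : k, s - algebraMap k L r ≠ 0 := by
    intro r hr
    obtain ⟨m, hm⟩ := hJ0.nonempty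
    have h1 := hc ⟨m, hm⟩
    rw [sub_eq_zero.1 hr, AlgHom.commutes,
      IsScalarTower.algebraMap_apply k k⟦X⟧ (FractionRing k⟦X⟧)] at h1
    have h2 := congrArg (PowerSeries.coeff 1) (hinj h1)
    change PowerSeries.coeff 1 (PowerSeries.C r) = _ at h2
    simp [PowerSeries.coeff_C] at h2
  have hfib : ∀ r : k, (c ⁻¹' {r}).Finite := by
    intro r
    refine (hfin _ (hs0 r)).subset ?_
    rintro l hl ⟨u, hu, hu'⟩
    simp only [Set.mem_preimage, Set.mem_singleton_iff] at hl
    have : φ l (s - algebraMap k L r) = algebraMap k⟦X⟧ _ PowerSeries.X := by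
      rw [map_sub, hc, AlgHom.commutes, hl,
        IsScalarTower.algebraMap_apply k k⟦X⟧ (FractionRing k⟦X⟧), ← map_sub]
      congr 1
      change PowerSeries.C r + PowerSeries.X - PowerSeries.C r = _
      ring
    rw [this] at hu'
    rw [← hinj hu', PowerSeries.isUnit_iff_constantCoeff] at hu
    simp at hu
  have : Infinite J0 := hJ0.to_subtype
  have hrange : (Set.range c).Infinite := by
    intro hr
    have := hr.preimage' (f := c) (fun b _ => hfib b)
    rw [Set.preimage_range] at this
    exact Set.infinite_univ this
  obtain ⟨J1, hJ1⟩ := (Set.surjOn_image c Set.univ).exists_bijOn_subset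
  obtain ⟨hJ1', hbij⟩ := hJ1
  have hJ1inf : J1.Infinite := by
    intro hf
    apply hrange
    rw [← Set.image_univ, ← hbij.image_eq]
    exact hf.image c
  have : Infinite J1 := hJ1inf.to_subtype
  obtain ⟨C, ε, hmem, hN, hε, hker, hfc⟩ := pid_construction (fun l : J1 => φ l) s
    (fun l => c l) (fun a b h => Subtype.ext (hbij.injOn a.2 b.2 h)) (fun l => hc l)
    (fun f hf => (hfin f hf).preimage Subtype.val_injective.injOn)
  have hjm : ∀ a : A, algebraMap A L a ∈ C := by
    intro a
    rw [hmem]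
    intro l
    obtain ⟨u, hu, _⟩ := hφ l a
    exact ⟨u, hu⟩
  refine ⟨C, inferInstance, inferInstance, inferInstance,
    (IsScalarTower.toAlgHom k A L).codRestrict C hjm, J1, inferInstance, fun l => (l : J0), ε, hN,
    fun a b h => Subtype.ext (Subtype.ext h), ?_, hker, hfc⟩
  intro l a
  obtain ⟨u, hu, hu'⟩ := hφ l a
  rw [← hu']
  exact hε l _ u hu

end PartFour
section PartFive
open TensorProduct

/-- solutions of `∑ b β x β = 0` generated in degrees `≤ D`. -/
def SolG {k R : Type} [Field k] [Ring R] [Algebra k R] (𝒜 : ℕ → Submodule k R) {ι : Type}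
    [Fintype ι] (b : ι → R) (δ : ι → ℕ) (D : ℕ) : Prop :=
  ∀ v : ι → R, ∑ β, b β * v β = 0 → v ∈ Submodule.span Rᵐᵒᵖ
    {w : ι → R | ∑ β, b β * w β = 0 ∧ ∃ j : ℕ, j ≤ D ∧ ∀ β, w β ∈ grZ k R 𝒜 ((j : ℤ) - δ β)}

theorem exists_proj {k R : Type} [Field k] [Ring R] [Algebra k R] (𝒜 : ℕ → Submodule k R)
    (hI : DirectSum.IsInternal 𝒜) :
    ∃ π : ℕ → R →ₗ[k] R, (∀ n r, π n r ∈ 𝒜 n) ∧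
      (∀ m n r, r ∈ 𝒜 m → π n r = if n = m then r else 0) ∧
      (∀ r, ∃ D, ∀ n, D < n → π n r = 0) ∧
      (∀ r D, (∀ n, D < n → π n r = 0) → r = ∑ n ∈ Finset.range (D + 1), π n r) := by
  classical
  let dec := hI.chooseDecomposition
  let π : ℕ → R →ₗ[k] R := fun n =>
    { toFun := fun r => (DirectSum.decompose 𝒜 r n : R)
      map_add' := fun x y => by simp
      map_smul' := fun c x => by rw [DirectSum.decompose_smul]; rfl }
  have hπ : ∀ n r, π n r = (DirectSum.decompose 𝒜 r n : R) := fun _ _ => rfl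
  have hsupp : ∀ r, ∃ D, ∀ n, D < n → π n r = 0 := by
    intro r
    refine ⟨(DirectSum.decompose 𝒜 r).support.sup id, fun n hn => ?_⟩
    rw [hπ]
    by_contra hne
    have : n ∈ (DirectSum.decompose 𝒜 r).support := by
      rw [DFinsupp.mem_support_iff]
      intro h
      exact hne (by rw [h]; rfl)
    have := Finset.le_sup (f := id) this
    simp only [id] at this
    omega
  refine ⟨π, fun n r => SetLike.coe_mem _, ?_, hsupp, ?_⟩
  · intro m n r hr
    rw [hπ, DirectSum.decompose_of_mem 𝒜 hr]
    split_ifs with h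
    · subst h; simp
    · rw [DirectSum.of_eq_of_ne _ _ _ h]; rfl
  · intro r D hD
    conv_lhs => rw [← DirectSum.sum_support_decompose 𝒜 r]
    apply Finset.sum_subset
    · intro n hn
      rw [Finset.mem_range]
      by_contra hlt
      rw [DFinsupp.mem_support_iff] at hn
      apply hn
      apply Subtype.ext
      exact hD n (by omega)
    · intro n _ hn
      rw [DFinsupp.notMem_support_iff] at hn
      rw [hn]; rfl

theorem proj_mul {k R : Type} [Field k] [Ring R] [Algebra k R] (𝒜 : ℕ → Submodule k R)
    (hmul : ∀ (i j : ℕ), ∀ x ∈ 𝒜 i, ∀ y ∈ 𝒜 j, x * y ∈ 𝒜 (i + j))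
    (π : ℕ → R →ₗ[k] R) (h1 : ∀ n r, π n r ∈ 𝒜 n)
    (h2 : ∀ m n r, r ∈ 𝒜 m → π n r = if n = m then r else 0)
    (h3 : ∀ r, ∃ D, ∀ n, D < n → π n r = 0)
    (h4 : ∀ r D, (∀ n, D < n → π n r = 0) → r = ∑ n ∈ Finset.range (D + 1), π n r)
    (m : ℕ) (x : R) (hx : x ∈ 𝒜 m) (y : R) (j : ℕ) :
    π j (x * y) = x * (if m ≤ j then π (j - m) y else 0) := by
  obtain ⟨D, hD⟩ := h3 y
  have hy := h4 y D hD
  conv_lhs => rw [hy, Finset.mul_sum, map_sum]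
  have : ∀ n ∈ Finset.range (D + 1), π j (x * π n y) = if j = m + n then x * π n y else 0 :=
    fun n _ => h2 _ _ _ (hmul m n x hx _ (h1 n y))
  rw [Finset.sum_congr rfl this]
  by_cases hmj : m ≤ j
  · rw [if_pos hmj]
    have h5 : ∀ n ∈ Finset.range (D + 1), (if j = m + n then x * π n y else 0) =
        if n = j - m then x * π n y else 0 := by
      intro n _
      congr 1
      apply propext
      omega
    rw [Finset.sum_congr rfl h5, Finset.sum_ite_eq']
    split_ifs with hlt
    · rfl
    · rw [hD _ (by rw [Finset.mem_range] at hlt; omega), mul_zero]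
  · rw [if_neg hmj, mul_zero]
    apply Finset.sum_eq_zero
    intro n _
    rw [if_neg (by omega)]

theorem homog_split {k R : Type} [Field k] [Ring R] [Algebra k R] (𝒜 : ℕ → Submodule k R)
    (hmul : ∀ (i j : ℕ), ∀ x ∈ 𝒜 i, ∀ y ∈ 𝒜 j, x * y ∈ 𝒜 (i + j))
    (π : ℕ → R →ₗ[k] R) (h1 : ∀ n r, π n r ∈ 𝒜 n)
    (h2 : ∀ m n r, r ∈ 𝒜 m → π n r = if n = m then r else 0)
    (h3 : ∀ r, ∃ D, ∀ n, D < n → π n r = 0)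
    (h4 : ∀ r D, (∀ n, D < n → π n r = 0) → r = ∑ n ∈ Finset.range (D + 1), π n r)
    {ι : Type} [Fintype ι] (b : ι → R) (δ : ι → ℕ) (hb : ∀ β, b β ∈ 𝒜 (δ β)) (d D : ℕ)
    (hδ : ∀ β, δ β ≤ d) (w : ι → R) (hw : ∑ β, b β * w β = 0)
    (hD : ∀ β n, D < n → π n (w β) = 0) :
    w ∈ Submodule.span Rᵐᵒᵖ {w : ι → R | ∑ β, b β * w β = 0 ∧
      ∃ j : ℕ, j ≤ D + d ∧ ∀ β, w β ∈ grZ k R 𝒜 ((j : ℤ) - δ β)} := by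
  classical
  let W : ℕ → ι → R := fun j β => if δ β ≤ j then π (j - δ β) (w β) else 0
  have hsum : w = ∑ j ∈ Finset.range (D + d + 1), W j := by
    funext β
    rw [Finset.sum_apply]
    conv_lhs => rw [h4 (w β) D (hD β)]
    have e : D + d + 1 = δ β + (D + 1 + (d - δ β)) := by have := hδ β; omega
    conv_rhs => rw [e, Finset.sum_range_add, Finset.sum_range_add]
    rw [Finset.sum_eq_zero (s := Finset.range (δ β)), zero_add]
    · rw [Finset.sum_eq_zero (s := Finset.range (d - δ β)), add_zero]
      · apply Finset.sum_congr rfl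
        intro n _
        simp [W]
      · intro n _
        simp only [W]
        rw [if_pos (by omega)]
        exact hD β _ (by omega)
    · intro n hn
      rw [Finset.mem_range] at hn
      simp only [W]
      rw [if_neg (by omega)]
  rw [hsum]
  apply Submodule.sum_mem
  intro j hj
  rw [Finset.mem_range] at hj
  apply Submodule.subset_span
  refine ⟨?_, j, by omega, ?_⟩
  · have : ∑ β, b β * W j β = π j (∑ β, b β * w β) := by
      rw [map_sum]
      apply Finset.sum_congr rfl
      intro β _
      rw [proj_mul 𝒜 hmul π h1 h2 h3 h4 (δ β) (b β) (hb β)]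
    rw [this, hw, map_zero]
  · intro β
    simp only [W, grZ]
    by_cases ha : δ β ≤ j
    · rw [if_pos ha, if_pos (by omega)]
      have : ((j : ℤ) - δ β).toNat = j - δ β := by omega
      rw [this]; exact h1 _ _
    · rw [if_neg ha]; exact zero_mem _

theorem noeth_op (S : Type) [Ring S] (h : IsNoetherianRing Sᵐᵒᵖ) : IsNoetherian Sᵐᵒᵖ S := by
  let e : Sᵐᵒᵖ ≃ₗ[Sᵐᵒᵖ] S :=
    { toFun := fun x => unop x
      invFun := fun x => op x
      map_add' := fun _ _ => rfl
      map_smul' := fun _ _ => rfl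
      left_inv := fun _ => rfl
      right_inv := fun _ => rfl }
  exact isNoetherian_of_linearEquiv e

/-- specialization `R ⊗ C → R` along a point of `C`. -/
noncomputable def spec {k R C : Type} [Field k] [Ring R] [Algebra k R] [CommRing C] [Algebra k C]
    (ε : C →ₐ[k] k) : (R ⊗[k] C) →ₐ[k] R :=
  (Algebra.TensorProduct.rid k k R).toAlgHom.comp
    (Algebra.TensorProduct.map (AlgHom.id k R) ε)

theorem spec_tmul {k R C : Type} [Field k] [Ring R] [Algebra k R] [CommRing C] [Algebra k C]
    (ε : C →ₐ[k] k) (r : R) (c : C) : spec ε (r ⊗ₜ[k] c) = ε c • r := by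
  simp [spec]

theorem spec_ker {k R C : Type} [Field k] [Ring R] [Algebra k R] [CommRing C] [Algebra k C]
    (ε : C →ₐ[k] k) (g : C) (hg : ∀ f, ε f = 0 → ∃ f', f = g * f') (s : R ⊗[k] C) :
    ∃ s', s = (spec ε s) ⊗ₜ[k] 1 + s' * ((1 : R) ⊗ₜ[k] g) := by
  induction s with
  | zero => exact ⟨0, by simp⟩
  | add x y hx hy =>
    obtain ⟨x', hx⟩ := hx
    obtain ⟨y', hy⟩ := hy
    refine ⟨x' + y', ?_⟩
    conv_lhs => rw [hx, hy]
    rw [map_add, TensorProduct.add_tmul, add_mul]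
    abel
  | tmul r c =>
    obtain ⟨f', hf'⟩ := hg (c - algebraMap k C (ε c)) (by rw [map_sub, AlgHom.commutes]; simp)
    refine ⟨r ⊗ₜ f', ?_⟩
    have : c = algebraMap k C (ε c) + g * f' := by rw [← hf']; ring
    conv_lhs => rw [this]
    rw [spec_tmul, TensorProduct.tmul_add, Algebra.TensorProduct.tmul_mul_tmul, mul_one, mul_comm g,
      TensorProduct.smul_tmul, Algebra.algebraMap_eq_smul_one]

theorem torsion_bound {k R C : Type} [Field k] [Ring R] [Algebra k R] [CommRing C] [IsDomain C]
    [Algebra k C] (hS : IsNoetherian (R ⊗[k] C)ᵐᵒᵖ (R ⊗[k] C))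
    (I : Submodule (R ⊗[k] C)ᵐᵒᵖ (R ⊗[k] C)) :
    ∃ c0 : C, c0 ≠ 0 ∧ ∀ (s : R ⊗[k] C) (c : C), c ≠ 0 → s * ((1 : R) ⊗ₜ[k] c) ∈ I →
      s * ((1 : R) ⊗ₜ[k] c0) ∈ I := by
  classical
  have hcomm : ∀ (c : C) (s : R ⊗[k] C), s * ((1 : R) ⊗ₜ[k] c) = ((1 : R) ⊗ₜ[k] c) * s := by
    intro c s
    induction s with
    | zero => simp
    | add x y hx hy => rw [add_mul, mul_add, hx, hy]
    | tmul r c' => simp [mul_comm]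
  have hmulC : ∀ (c c' : C), ((1 : R) ⊗ₜ[k] (c * c')) = ((1 : R) ⊗ₜ[k] c) * ((1 : R) ⊗ₜ[k] c') := by
    intro c c'; simp
  have hIr : ∀ x ∈ I, ∀ t, x * t ∈ I := fun x hx t => I.smul_mem (op t) hx
  let T : Submodule (R ⊗[k] C)ᵐᵒᵖ (R ⊗[k] C) :=
    { carrier := {s | ∃ c : C, c ≠ 0 ∧ s * ((1 : R) ⊗ₜ[k] c) ∈ I}
      add_mem' := by
        rintro x y ⟨c, hc, hx⟩ ⟨c', hc', hy⟩
        refine ⟨c * c', mul_ne_zero hc hc', ?_⟩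
        rw [add_mul]
        refine I.add_mem ?_ ?_
        · rw [hmulC, ← mul_assoc]; exact hIr _ hx _
        · rw [mul_comm c, hmulC, ← mul_assoc]; exact hIr _ hy _
      zero_mem' := ⟨1, one_ne_zero, by rw [zero_mul]; exact I.zero_mem⟩
      smul_mem' := by
        rintro t x ⟨c, hc, hx⟩
        refine ⟨c, hc, ?_⟩
        rw [← op_unop t, op_smul_eq_mul, mul_assoc, hcomm, ← mul_assoc]
        exact hIr _ hx _ }
  obtain ⟨G, hG⟩ := hS.noetherian T
  have hGT : ∀ x ∈ G, ∃ c : C, c ≠ 0 ∧ x * ((1 : R) ⊗ₜ[k] c) ∈ I := by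
    intro x hx
    have : x ∈ T := by rw [← hG]; exact Submodule.subset_span hx
    exact this
  choose! cc hcc0 hcc using hGT
  refine ⟨∏ x ∈ G, cc x, Finset.prod_ne_zero_iff.2 hcc0, ?_⟩
  intro s c hc hs
  have hsT : s ∈ Submodule.span (R ⊗[k] C)ᵐᵒᵖ (G : Set (R ⊗[k] C)) := by
    rw [hG]; exact ⟨c, hc, hs⟩
  clear hs hc
  induction hsT using Submodule.span_induction with
  | mem x hx =>
    rw [← Finset.mul_prod_erase G cc hx, hmulC, ← mul_assoc]
    exact hIr _ (hcc x hx) _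
  | zero => rw [zero_mul]; exact I.zero_mem
  | add x y _ _ hx hy => rw [add_mul]; exact I.add_mem hx hy
  | smul t x _ hx =>
    rw [← op_unop t, op_smul_eq_mul, mul_assoc, hcomm, ← mul_assoc]
    exact hIr _ hx _

theorem uniform_bound {k R C : Type} [Field k] [Ring R] [Algebra k R] [CommRing C] [IsDomain C]
    [Algebra k C] (𝒜 : ℕ → Submodule k R)
    (hmul : ∀ (i j : ℕ), ∀ x ∈ 𝒜 i, ∀ y ∈ 𝒜 j, x * y ∈ 𝒜 (i + j))
    (hI : DirectSum.IsInternal 𝒜)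
    (hSop : IsNoetherianRing (R ⊗[k] C)ᵐᵒᵖ) {ι : Type} [Fintype ι] (d : ℕ) (δ : ι → ℕ)
    (hδ : ∀ β, δ β ≤ d) (b : ι → R ⊗[k] C)
    (hb : ∀ (ε : C →ₐ[k] k) β, spec ε (b β) ∈ 𝒜 (δ β)) :
    ∃ (D : ℕ) (c0 : C), c0 ≠ 0 ∧ ∀ (ε : C →ₐ[k] k) (g : C), ε g = 0 →
      (∀ f, ε f = 0 → ∃ f', f = g * f') → ε c0 ≠ 0 →
      SolG 𝒜 (fun β => spec ε (b β)) δ D := by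
  classical
  have hS : IsNoetherian (R ⊗[k] C)ᵐᵒᵖ (R ⊗[k] C) := noeth_op _ hSop
  have hcomm : ∀ (c : C) (s : R ⊗[k] C), s * ((1 : R) ⊗ₜ[k] c) = ((1 : R) ⊗ₜ[k] c) * s := by
    intro c s
    induction s with
    | zero => simp
    | add x y hx hy => rw [add_mul, mul_add, hx, hy]
    | tmul r c' => simp [mul_comm]
  let Φ : (ι → R ⊗[k] C) →ₗ[(R ⊗[k] C)ᵐᵒᵖ] (R ⊗[k] C) :=
    { toFun := fun v => ∑ β, b β * v β
      map_add' := fun v w => by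
        simp only [Pi.add_apply, mul_add, Finset.sum_add_distrib]
      map_smul' := fun t v => by
        rw [← op_unop t]
        simp only [Pi.smul_apply, op_smul_eq_mul, RingHom.id_apply, Finset.sum_mul, mul_assoc] }
  have hΦ : ∀ v, Φ v = ∑ β, b β * v β := fun _ => rfl
  obtain ⟨c0, hc0, htor⟩ := torsion_bound hS (LinearMap.range Φ)
  have hpi : IsNoetherian (R ⊗[k] C)ᵐᵒᵖ (ι → R ⊗[k] C) := inferInstance
  obtain ⟨G, hG⟩ := hpi.noetherian (LinearMap.ker Φ)
  obtain ⟨π, h1, h2, h3, h4⟩ := exists_proj 𝒜 hI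
  -- uniform degree bound for one element
  have hdeg : ∀ x : R ⊗[k] C, ∃ D : ℕ, ∀ ε : C →ₐ[k] k, ∀ n, D < n → π n (spec ε x) = 0 := by
    intro x
    induction x with
    | zero => exact ⟨0, by simp⟩
    | add x y hx hy =>
      obtain ⟨D, hD⟩ := hx
      obtain ⟨D', hD'⟩ := hy
      refine ⟨max D D', fun ε n hn => ?_⟩
      rw [map_add, map_add, hD ε n (lt_of_le_of_lt (le_max_left _ _) hn),
        hD' ε n (lt_of_le_of_lt (le_max_right _ _) hn), add_zero]
    | tmul r c =>
      obtain ⟨D, hD⟩ := h3 r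
      refine ⟨D, fun ε n hn => ?_⟩
      rw [spec_tmul, map_smul, hD n hn, smul_zero]
  choose DD hDD using hdeg
  let D0 : ℕ := G.sup fun w => Finset.univ.sup fun β => DD (w β)
  refine ⟨D0 + d, c0, hc0, ?_⟩
  intro ε g hεg hg hεc v hv
  have hsp1 : ∀ c : C, spec ε ((1 : R) ⊗ₜ[k] c) = algebraMap k R (ε c) := by
    intro c; rw [spec_tmul, Algebra.algebraMap_eq_smul_one]
  -- specialization of the kernel
  have hker : ∀ z : ι → R ⊗[k] C, Φ z = 0 → (fun β => spec ε (z β)) ∈ Submodule.span Rᵐᵒᵖ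
    {w : ι → R | ∑ β, spec ε (b β) * w β = 0 ∧
      ∃ j : ℕ, j ≤ D0 + d ∧ ∀ β, w β ∈ grZ k R 𝒜 ((j : ℤ) - δ β)} := by
    intro z hz
    have hz' : z ∈ Submodule.span (R ⊗[k] C)ᵐᵒᵖ (G : Set (ι → R ⊗[k] C)) := by
      rw [hG]; exact hz
    clear hz
    induction hz' using Submodule.span_induction with
    | mem w hw =>
      refine homog_split 𝒜 hmul π h1 h2 h3 h4 _ δ (hb ε) d D0 hδ _ ?_ ?_
      · have : Φ w = 0 := by
          have : w ∈ LinearMap.ker Φ := by rw [← hG]; exact Submodule.subset_span hw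
          exact this
        rw [hΦ] at this
        have := congrArg (spec ε) this
        rw [map_sum, map_zero] at this
        simpa only [map_mul] using this
      · intro β n hn
        apply hDD
        refine lt_of_le_of_lt ?_ hn
        exact (Finset.le_sup (f := fun β => DD (w β)) (Finset.mem_univ β)).trans
          (Finset.le_sup (f := fun w : ι → R ⊗[k] C => Finset.univ.sup fun β => DD (w β)) hw)
    | zero =>
      have : (fun β => spec ε ((0 : ι → R ⊗[k] C) β)) = 0 := by
        funext β; simp
      rw [this]; exact Submodule.zero_mem _
    | add x y _ _ hx hy =>
      have : (fun β => spec ε ((x + y) β)) =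
          (fun β => spec ε (x β)) + (fun β => spec ε (y β)) := by
        funext β; simp
      rw [this]; exact Submodule.add_mem _ hx hy
    | smul t x _ hx =>
      have : (fun β => spec ε ((t • x) β)) = op (spec ε (unop t)) • (fun β => spec ε (x β)) := by
        funext β
        rw [← op_unop t]
        simp only [Pi.smul_apply, op_smul_eq_mul, map_mul, unop_op]
      rw [this]; exact Submodule.smul_mem _ _ hx
  obtain ⟨s, hs⟩ := spec_ker ε g hg (Φ fun β => v β ⊗ₜ[k] (1 : C))
  have hsp0 : spec ε (Φ fun β => v β ⊗ₜ[k] (1 : C)) = 0 := by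
    rw [hΦ, map_sum, ← hv]
    apply Finset.sum_congr rfl
    intro β _
    rw [map_mul, spec_tmul, map_one, one_smul]
  rw [hsp0, TensorProduct.zero_tmul, zero_add] at hs
  -- a kernel element specializing to a multiple of `v`
  have hz : ∃ z : ι → R ⊗[k] C, Φ z = 0 ∧
      (fun β => spec ε (z β)) = op (algebraMap k R (ε c0)) • v := by
    by_cases hg0 : g = 0
    · refine ⟨op ((1 : R) ⊗ₜ[k] c0) • (fun β => v β ⊗ₜ[k] (1 : C)), ?_, ?_⟩
      · rw [map_smul, hs, hg0, TensorProduct.tmul_zero, mul_zero, smul_zero]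
      · funext β
        simp only [Pi.smul_apply, op_smul_eq_mul, map_mul, hsp1]
        rw [spec_tmul, map_one, one_smul]
    · have hsT : s * ((1 : R) ⊗ₜ[k] c0) ∈ LinearMap.range Φ :=
        htor s g hg0 ⟨_, hs⟩
      obtain ⟨w, hw⟩ := hsT
      refine ⟨op ((1 : R) ⊗ₜ[k] c0) • (fun β => v β ⊗ₜ[k] (1 : C)) - op ((1 : R) ⊗ₜ[k] g) • w,
        ?_, ?_⟩
      · rw [map_sub, map_smul, map_smul, hs, hw, op_smul_eq_mul, op_smul_eq_mul, mul_assoc,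
          hcomm c0, ← mul_assoc, sub_eq_zero, mul_assoc]
      · funext β
        simp only [Pi.smul_apply, Pi.sub_apply, op_smul_eq_mul, map_mul, map_sub, hsp1, hεg,
          map_zero, mul_zero, sub_zero]
        rw [spec_tmul, map_one, one_smul]
  obtain ⟨z, hz0, hzv⟩ := hz
  have hfin := hker z hz0
  rw [hzv] at hfin
  have := Submodule.smul_mem _ (op (algebraMap k R (ε c0)⁻¹)) hfin
  rw [smul_smul, ← op_mul, ← map_mul, mul_inv_cancel₀ hεc, map_one, op_one, one_smul] at this
  exact this

end PartFive
section PartSix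
open TensorProduct

theorem SolG.mono {k R : Type} [Field k] [Ring R] [Algebra k R] {𝒜 : ℕ → Submodule k R} {ι : Type}
    [Fintype ι] {b : ι → R} {δ : ι → ℕ} {D D' : ℕ} (hD : D ≤ D') (h : SolG 𝒜 b δ D) :
    SolG 𝒜 b δ D' := by
  intro v hv
  refine Submodule.span_mono ?_ (h v hv)
  rintro w ⟨h1, j, hj, h2⟩
  exact ⟨h1, j, hj.trans hD, h2⟩

/-- the family of coefficient vectors with parameters `t`. -/
noncomputable def fam {k R : Type} [Field k] [Ring R] [Algebra k R] {ι : Type} [Fintype ι]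
    (δ : ι → ℕ) (e : ι → R) (t : ι × ι → k) (β : ι) : R :=
  ∑ α, if δ α = δ β then t (α, β) • e α else 0

theorem param_bound {k R : Type} [Field k] [IsAlgClosed k] [Ring R] [Algebra k R]
    (𝒜 : ℕ → Submodule k R)
    (hmul : ∀ (i j : ℕ), ∀ x ∈ 𝒜 i, ∀ y ∈ 𝒜 j, x * y ∈ 𝒜 (i + j))
    (hI : DirectSum.IsInternal 𝒜)
    (hSN : ∀ (C : Type) [CommRing C] [Algebra k C], IsNoetherianRing C →
      IsNoetherianRing (TensorProduct k R C)ᵐᵒᵖ)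
    {ι : Type} [Fintype ι] (d : ℕ) (δ : ι → ℕ) (hδ : ∀ β, δ β ≤ d) (e : ι → R)
    (he : ∀ α, e α ∈ 𝒜 (δ α)) :
    ∃ D : ℕ, ∀ t : ι × ι → k, SolG 𝒜 (fam δ e t) δ D := by
  classical
  by_contra hcon
  push Not at hcon
  let V : Ideal (MvPolynomial (ι × ι) k) → ℕ → Prop := fun I m =>
    ∃ t : ι × ι → k, ¬ SolG 𝒜 (fam δ e t) δ m ∧ ∀ f ∈ I, MvPolynomial.aeval t f = 0
  let X : Set (Ideal (MvPolynomial (ι × ι) k)) := {I | ∀ m, V I m}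
  have hX : X.Nonempty := by
    refine ⟨⊥, fun m => ?_⟩
    obtain ⟨t, ht⟩ := hcon m
    refine ⟨t, ht, fun f hf => ?_⟩
    rw [Ideal.mem_bot] at hf
    rw [hf, map_zero]
  obtain ⟨P, hPX, hmax⟩ : ∃ P : Ideal (MvPolynomial (ι × ι) k), P ∈ X ∧ ∀ I ∈ X, ¬ P < I :=
    set_has_maximal_iff_noetherian.2
    (inferInstance : IsNoetherian (MvPolynomial (ι × ι) k) (MvPolynomial (ι × ι) k)) X hX
  have hout : ∀ f, f ∉ P → ∃ m, ∀ m' ≥ m, ∀ t : ι × ι → k, ¬ SolG 𝒜 (fam δ e t) δ m' →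
      (∀ f ∈ P, MvPolynomial.aeval t f = 0) → MvPolynomial.aeval t f ≠ 0 := by
    intro f hf
    have hlt : P < P ⊔ Ideal.span {f} := by
      refine lt_of_le_of_ne le_sup_left ?_
      intro h
      apply hf
      rw [h]
      exact Ideal.mem_sup_right (Ideal.mem_span_singleton_self f)
    have hnX : P ⊔ Ideal.span {f} ∉ X := fun h => hmax _ h hlt
    have hnX' : ¬ ∀ m, V (P ⊔ Ideal.span {f}) m := hnX
    push Not at hnX'
    obtain ⟨m, hm⟩ := hnX'
    refine ⟨m, fun m' hm' t ht htP h0 => hm ⟨t, fun h => ht (h.mono hm'), ?_⟩⟩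
    have hle : P ⊔ Ideal.span {f} ≤ RingHom.ker (MvPolynomial.aeval t : MvPolynomial (ι × ι) k →ₐ[k] k) := by
      refine sup_le htP ?_
      rw [Ideal.span_singleton_le_iff_mem]
      exact h0
    exact fun g hg => hle hg
  have hPX' : ∀ m, V P m := hPX
  choose t ht htP using hPX'
  have hprime : Ideal.IsPrime P := by
    refine ⟨?_, ?_⟩
    · intro h
      have := htP 0 1 (by rw [h]; trivial)
      rw [map_one] at this
      exact one_ne_zero this
    · intro f g hfg
      by_contra hno
      push Not at hno
      obtain ⟨m1, h1⟩ := hout f hno.1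
      obtain ⟨m2, h2⟩ := hout g hno.2
      have h3 := htP (max m1 m2) _ hfg
      rw [map_mul] at h3
      rcases mul_eq_zero.1 h3 with h | h
      · exact h1 _ (le_max_left _ _) _ (ht _) (htP _) h
      · exact h2 _ (le_max_right _ _) _ (ht _) (htP _) h
  let A : Type := MvPolynomial (ι × ι) k ⧸ P
  let p : ℕ → A →ₐ[k] k := fun m => Ideal.Quotient.liftₐ P (MvPolynomial.aeval (t m)) (htP m)
  have hp : ∀ a : A, a ≠ 0 → {m | p m a = 0}.Finite := by
    intro a ha
    obtain ⟨f, rfl⟩ := Ideal.Quotient.mk_surjective a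
    have hf : f ∉ P := fun h => ha (Ideal.Quotient.eq_zero_iff_mem.2 h)
    obtain ⟨m, hm⟩ := hout f hf
    refine (Set.finite_lt_nat m).subset ?_
    intro m' hm'
    by_contra hlt
    have hlt' : m ≤ m' := by
      by_contra h
      exact hlt (by simpa using h)
    exact hm m' hlt' (t m') (ht m') (htP m') hm'
  have hdomA : IsDomain A := Ideal.Quotient.isDomain P
  obtain ⟨C, _, _, _, j, J, _, idx, ε, hN, hidx, hε, hker, hfin⟩ := curve_thm k A p hp
  let b : ι → R ⊗[k] C := fun β => ∑ α, if δ α = δ β then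
    e α ⊗ₜ[k] (j (Ideal.Quotient.mk P (MvPolynomial.X (α, β)))) else 0
  have hspb : ∀ (η : C →ₐ[k] k) β, spec η (b β) = ∑ α, if δ α = δ β then
    η (j (Ideal.Quotient.mk P (MvPolynomial.X (α, β)))) • e α else 0 := by
    intro η β
    simp only [b]
    rw [map_sum]
    apply Finset.sum_congr rfl
    intro α _
    split_ifs
    · rw [spec_tmul]
    · rw [map_zero]
  obtain ⟨D, c0, hc0, hD⟩ := uniform_bound 𝒜 hmul hI (hSN C hN) d δ hδ b (by
    intro η β
    rw [hspb]
    apply Submodule.sum_mem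
    intro α _
    split_ifs with h
    · rw [← h]; exact Submodule.smul_mem _ _ (he α)
    · exact zero_mem _)
  have hfin2 : ({l | ε l c0 = 0} ∪ {l | idx l < D}).Finite :=
    (hfin c0 hc0).union ((Set.finite_lt_nat D).preimage hidx.injOn)
  obtain ⟨l, hl⟩ := hfin2.infinite_compl.nonempty
  have hl1 : ε l c0 ≠ 0 := fun h => hl (Or.inl h)
  have hl2 : D ≤ idx l := not_lt.1 fun h => hl (Or.inr h)
  obtain ⟨g, hg0, hg⟩ := hker l
  have hsol := hD (ε l) g hg0 hg hl1
  have heq : (fun β => spec (ε l) (b β)) = fam δ e (t (idx l)) := by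
    funext β
    rw [hspb]
    unfold fam
    apply Finset.sum_congr rfl
    intro α _
    rw [hε]
    have : p (idx l) (Ideal.Quotient.mk P (MvPolynomial.X (α, β))) = t (idx l) (α, β) := by
      change Ideal.Quotient.liftₐ P (MvPolynomial.aeval (t (idx l))) (htP (idx l))
        (Ideal.Quotient.mk P (MvPolynomial.X (α, β))) = _
      exact (Ideal.Quotient.lift_mk P _ _).trans (MvPolynomial.aeval_X _ _)
    rw [this]
  rw [heq] at hsol
  exact ht _ (hsol.mono hl2)

theorem transfer {k R : Type} [Field k] [Ring R] [Algebra k R] (𝒜 : ℕ → Submodule k R)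
    (h0 : (1 : R) ∈ 𝒜 0) {ι : Type} [Fintype ι] (d D : ℕ) (hdD : d ≤ D) (δ : ι → ℕ) (b : ι → R)
    (hb : SolG 𝒜 b δ D) {n : ℕ} (a : Fin n → R) (dg : Fin n → ℤ) (hdg : ∀ i, dg i ≤ (d : ℤ))
    (lam : Fin n → ι → k) (mu : ι → Fin n → k)
    (hlam : ∀ i β, dg i ≠ δ β → lam i β = 0) (hmu : ∀ β i, dg i ≠ δ β → mu β i = 0)
    (ha : ∀ i, a i = ∑ β, lam i β • b β) (hbm : ∀ β, b β = ∑ i, mu β i • a i) :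
    SolGenLE k R R 𝒜 a dg (D : ℤ) := by
  classical
  intro v hv
  have hv' : ∑ i, a i * v i = 0 := hv
  let T : (ι → R) →ₗ[Rᵐᵒᵖ] (Fin n → R) :=
    { toFun := fun w i => ∑ β, mu β i • w β
      map_add' := fun w w' => by
        funext i; simp only [Pi.add_apply, smul_add, Finset.sum_add_distrib]
      map_smul' := fun r w => by
        funext i
        simp only [Pi.smul_apply, RingHom.id_apply, Finset.smul_sum]
        rw [← op_unop r]
        simp only [op_smul_eq_mul, smul_mul_assoc] }
  have hT : ∀ w i, T w i = ∑ β, mu β i • w β := fun _ _ => rfl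
  have hTs : ∀ w, ∑ i, a i * T w i = ∑ β, b β * w β := by
    intro w
    simp only [hT, Finset.mul_sum]
    rw [Finset.sum_comm]
    apply Finset.sum_congr rfl
    intro β _
    conv_rhs => rw [hbm β, Finset.sum_mul]
    apply Finset.sum_congr rfl
    intro i _
    rw [mul_smul_comm, smul_mul_assoc]
  set SS : Set (Fin n → R) :=
    {w : Fin n → R | IsSol R R a w ∧ ∃ j ≤ (D : ℤ), FreeHomog k R 𝒜 dg w j} with hSS
  let u : ι → R := fun β => ∑ i, lam i β • v i
  have hu : ∑ β, b β * u β = 0 := by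
    rw [← hv']
    simp only [u, Finset.mul_sum]
    rw [Finset.sum_comm]
    apply Finset.sum_congr rfl
    intro i _
    conv_rhs => rw [ha i, Finset.sum_mul]
    apply Finset.sum_congr rfl
    intro β _
    rw [mul_smul_comm, smul_mul_assoc]
  have hTu : T u ∈ Submodule.span Rᵐᵒᵖ SS := by
    have h1 := Submodule.mem_map_of_mem (f := T) (hb u hu)
    rw [Submodule.map_span] at h1
    refine Submodule.span_mono ?_ h1
    rintro _ ⟨w, ⟨hw, j, hj, hwj⟩, rfl⟩
    refine ⟨?_, j, by exact_mod_cast hj, ?_⟩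
    · change ∑ i, a i * T w i = 0
      rw [hTs, hw]
    · intro i
      rw [hT]
      apply Submodule.sum_mem
      intro β _
      by_cases h : dg i = δ β
      · rw [h]; exact Submodule.smul_mem _ _ (hwj β)
      · rw [hmu β i h, zero_smul]; exact zero_mem _
  let E : Fin n → Fin n → R := fun i => Pi.single i 1 - T (fun β => lam i β • (1 : R))
  have hE : ∀ i, E i ∈ SS := by
    intro i
    have hz : ∀ m, dg m = dg i → (1 : R) ∈ grZ k R 𝒜 (dg i - dg m) := by
      intro m hm
      rw [hm, sub_self]
      simpa [grZ] using h0
    refine ⟨?_, dg i, (hdg i).trans (by exact_mod_cast hdD), ?_⟩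
    · change ∑ m, a m * E i m = 0
      simp only [E, Pi.sub_apply, mul_sub, Finset.sum_sub_distrib]
      rw [hTs, sub_eq_zero]
      simp only [mul_smul_comm, mul_one]
      rw [← ha i]
      rw [Finset.sum_eq_single i]
      · simp
      · intro m _ hm
        rw [Pi.single_eq_of_ne hm, mul_zero]
      · simp
    · intro m
      simp only [E, Pi.sub_apply]
      refine Submodule.sub_mem _ ?_ ?_
      · by_cases hm : m = i
        · subst hm
          rw [Pi.single_eq_same]; exact hz m rfl
        · rw [Pi.single_eq_of_ne hm]; exact zero_mem _
      · rw [hT]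
        apply Submodule.sum_mem
        intro β _
        by_cases h1 : dg m = δ β
        · by_cases h2 : dg i = δ β
          · exact Submodule.smul_mem _ _ (Submodule.smul_mem _ _ (hz m (h1.trans h2.symm)))
          · rw [hlam i β h2, zero_smul, smul_zero]; exact zero_mem _
        · rw [hmu β m h1, zero_smul]; exact zero_mem _
  have hdecomp : v = T u + ∑ i, op (v i) • E i := by
    funext m
    simp only [Pi.add_apply, Finset.sum_apply, Pi.smul_apply, E, Pi.sub_apply, op_smul_eq_mul,
      sub_mul, Finset.sum_sub_distrib]
    have e1 : ∑ i, (Pi.single i (1 : R) : Fin n → R) m * v i = v m := by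
      rw [Finset.sum_eq_single m]
      · simp
      · intro i _ hi
        rw [Pi.single_eq_of_ne (Ne.symm hi), zero_mul]
      · simp
    have e2 : ∑ i, T (fun β => lam i β • (1 : R)) m * v i = T u m := by
      simp only [hT, u, Finset.sum_mul, Finset.smul_sum]
      rw [Finset.sum_comm]
      simp only [smul_mul_assoc, one_mul]
    rw [e1, e2]
    abel
  rw [hdecomp]
  refine Submodule.add_mem _ hTu (Submodule.sum_mem _ fun i _ => ?_)
  exact Submodule.smul_mem _ _ (Submodule.subset_span (hE i))

theorem degree_bound {k R : Type} [Field k] [IsAlgClosed k] [Ring R] [Algebra k R]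
    (𝒜 : ℕ → Submodule k R) (hconn : IsConnAlg k R 𝒜) (hlf : LocFin k R 𝒜)
    (hSN : ∀ (C : Type) [CommRing C] [Algebra k C], IsNoetherianRing C →
      IsNoetherianRing (TensorProduct k R C)ᵐᵒᵖ) (d : ℕ) :
    ∃ D : ℕ, d ≤ D ∧ ∀ (n : ℕ) (a : Fin n → R) (dg : Fin n → ℤ),
      (∀ i, a i ∈ grZ k R 𝒜 (dg i)) → (∀ i, dg i ≤ (d : ℤ)) → SolGenLE k R R 𝒜 a dg (D : ℤ) := by
  classical
  obtain ⟨hmul, hI, hzero⟩ := hconn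
  obtain ⟨π, hπ1, hπ2, -, -⟩ := exists_proj 𝒜 hI
  have hfg : ∀ i, ∃ (N : ℕ) (s : Fin N → 𝒜 i), Submodule.span k (Set.range s) = ⊤ := by
    intro i
    have := hlf i
    exact Module.Finite.exists_fin
  choose N s hs using hfg
  let ι : Type := Σ i : Fin (d + 1), Fin (N i)
  let δ : ι → ℕ := fun β => β.1
  let e : ι → R := fun β => (s β.1 β.2 : R)
  have he : ∀ α, e α ∈ 𝒜 (δ α) := fun α => (s α.1 α.2).2
  have hδ : ∀ β, δ β ≤ d := fun β => Nat.lt_succ_iff.1 β.1.2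
  have hspan : ∀ j ≤ d, ∀ x ∈ 𝒜 j, ∃ c : ι → k, (∀ β, δ β ≠ j → c β = 0) ∧
      x = ∑ β, c β • e β := by
    intro j hj x hx
    have hc : ∀ i, ∃ c : Fin (N i) → k, ∑ m, c m • s i m = ⟨π i x, hπ1 i x⟩ := by
      intro i
      have : (⟨π i x, hπ1 i x⟩ : 𝒜 i) ∈ Submodule.span k (Set.range (s i)) := by
        rw [hs]; trivial
      exact (Submodule.mem_span_range_iff_exists_fun k).1 this
    choose c hc using hc
    refine ⟨fun β => if δ β = j then c β.1 β.2 else 0, fun β hβ => if_neg hβ, ?_⟩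
    rw [Fintype.sum_sigma]
    rw [Finset.sum_eq_single (⟨j, Nat.lt_succ_iff.2 hj⟩ : Fin (d + 1))]
    · simp only [δ, if_true]
      have this : ((∑ m, c j m • s j m : 𝒜 j) : R) = π j x := congrArg Subtype.val (hc j)
      rw [hπ2 j j x hx, if_pos rfl] at this
      rw [← this]
      simp [e]
    · intro i _ hi
      apply Finset.sum_eq_zero
      intro m _
      have : δ ⟨i, m⟩ ≠ j := fun h => hi (Fin.ext h)
      simp only [if_neg this, zero_smul]
    · simp
  obtain ⟨D0, hD0⟩ := param_bound 𝒜 hmul hI hSN d δ hδ e he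
  refine ⟨max D0 d, le_max_right _ _, ?_⟩
  intro n a dg ha hdg
  let a' : ℕ → Fin n → R := fun j i => if dg i = j then a i else 0
  let W : ℕ → Submodule k R := fun j => Submodule.span k (Set.range (a' j))
  have hW : ∀ j, W j ≤ 𝒜 j := by
    intro j
    rw [Submodule.span_le]
    rintro _ ⟨i, rfl⟩
    simp only [a']
    split_ifs with h
    · have := ha i
      rw [h] at this
      simpa [grZ] using this
    · exact zero_mem _
  have hq : ∀ j, ∃ q : R →ₗ[k] R, (∀ x, q x ∈ W j) ∧ ∀ x ∈ W j, q x = x := by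
    intro j
    obtain ⟨q, hq⟩ := LinearMap.exists_leftInverse_of_injective (W j).subtype
      (LinearMap.ker_eq_bot.2 (W j).injective_subtype)
    refine ⟨(W j).subtype.comp q, fun x => (q x).2, fun x hx => ?_⟩
    have := DFunLike.congr_fun hq (⟨x, hx⟩ : W j)
    exact congrArg Subtype.val this
  choose q hq1 hq2 using hq
  have ht : ∀ β, ∃ c : ι → k, (∀ α, δ α ≠ δ β → c α = 0) ∧ q (δ β) (e β) = ∑ α, c α • e α :=
    fun β => hspan (δ β) (hδ β) _ (hW _ (hq1 _ _))
  choose t ht0 ht using ht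
  let b : ι → R := fam δ e (fun x => t x.2 x.1)
  have hb : ∀ β, b β = q (δ β) (e β) := by
    intro β
    rw [ht]
    simp only [b, fam]
    apply Finset.sum_congr rfl
    intro α _
    split_ifs with h
    · rfl
    · rw [ht0 β α h, zero_smul]
  have hmu : ∀ β, ∃ c : Fin n → k, ∑ i, c i • a' (δ β) i = b β := by
    intro β
    rw [hb]
    exact (Submodule.mem_span_range_iff_exists_fun k).1 (hq1 (δ β) (e β))
  choose mu hmu using hmu
  have hlam : ∀ i, ∃ c : ι → k, (∀ β, dg i ≠ δ β → c β = 0) ∧ a i = ∑ β, c β • b β := by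
    intro i
    by_cases hneg : 0 ≤ dg i
    · obtain ⟨j, hj⟩ := Int.eq_ofNat_of_zero_le hneg
      have hjd : j ≤ d := by have := hdg i; omega
      have haW : a i ∈ W j := Submodule.subset_span ⟨i, by simp [a', hj]⟩
      obtain ⟨c, hc0, hc⟩ := hspan j hjd (a i) (hW j haW)
      refine ⟨c, fun β hβ => hc0 β fun h => hβ (by rw [hj, h]), ?_⟩
      have := congrArg (q j) hc
      rw [hq2 j _ haW, map_sum] at this
      rw [this]
      apply Finset.sum_congr rfl
      intro β _
      rw [map_smul]
      by_cases h : δ β = j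
      · rw [hb, h]
      · rw [hc0 β h, zero_smul, zero_smul]
    · refine ⟨0, fun _ _ => rfl, ?_⟩
      have := ha i
      simp only [grZ, if_neg hneg, Submodule.mem_bot] at this
      simp [this]
  choose lam hlam0 hlam using hlam
  refine transfer 𝒜 (by rw [hzero]; exact Submodule.mem_span_singleton_self 1) d (max D0 d)
    (le_max_right _ _) δ b ((hD0 _).mono (le_max_left _ _)) a dg hdg lam
    (fun β i => if dg i = δ β then mu β i else 0) (fun i β h => hlam0 i β h)
    (fun β i h => if_neg h) hlam ?_
  intro β
  rw [← hmu β]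
  apply Finset.sum_congr rfl
  intro i _
  simp only [a']
  split_ifs <;> simp

end PartSix

/-- a right strongly Noetherian connected graded algebra over an
algebraically closed field is right Noetherian and effectively coherent. -/
theorem statement_12 (k R : Type) [Field k] [IsAlgClosed k] [Ring R] [Algebra k R]
    (𝒜 : ℕ → Submodule k R) (hconn : IsConnAlg k R 𝒜) (hlf : LocFin k R 𝒜)
    (hfga : FinGenAlg k R)
    (hSN : ∀ (C : Type) [CommRing C] [Algebra k C], IsNoetherianRing C →
      IsNoetherianRing (TensorProduct k R C)ᵐᵒᵖ) :
    IsNoetherian Rᵐᵒᵖ R ∧ EffCohAlg k R 𝒜 := by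
  constructor
  · have h1 := hSN k inferInstance
    have e : (TensorProduct k R k)ᵐᵒᵖ ≃+* Rᵐᵒᵖ :=
      RingEquiv.op (Algebra.TensorProduct.rid k k R).toRingEquiv
    exact noeth_op R (isNoetherianRing_of_ringEquiv _ e)
  · choose D hD1 hD2 using fun d => degree_bound 𝒜 hconn hlf hSN d
    exact ⟨D, hD1, fun d n a dg ha hdg => hD2 d n a dg ha hdg⟩

end NCG
end

section
/- Let R be a connected finitely generated locally finite graded k-algebra carrying a coherent family F of right ideals. Then: (a) the trivial module k_R and every ideal I ∈ F admit resolutions by finitely generated graded free right R-modules (free resolutions of finite type); (b) if moreover F has degree ≤ d, then every I ∈ F admits a graded free resolution ⋯ → F_i → ⋯ → F_1 → F_0 → I → 0 in which each F_i is finite graded free with homogeneous basis in degrees ≤ m(I) + d·i, and, if R is generated in degree one, k_R admits a graded free resolution whose i-th free module (i ≥ 1) has homogeneous basis in degrees ≤ 1 + d·(i−1) (i.e., the Backelin rate of R is at most d). -/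
open MulOpposite

namespace NCG

variable (k : Type) [Field k] (R : Type) [Ring R] [Algebra k R]

variable (M : Type) [AddCommGroup M] [Module Rᵐᵒᵖ M] [Module k M]

section Aux

variable {N : Type} [AddCommGroup N] [Module Rᵐᵒᵖ N]
  {P : Type} [AddCommGroup P] [Module Rᵐᵒᵖ P]

/-- colon ideal of an element of a module with respect to a submodule. -/
def colonM (x : N) (L : Submodule Rᵐᵒᵖ N) : Submodule Rᵐᵒᵖ R where
  carrier := {a : R | op a • x ∈ L}
  add_mem' := by
    intro a b ha hb
    simp only [Set.mem_ofPred_eq, op_add, add_smul] at *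
    exact L.add_mem ha hb
  zero_mem' := by simp
  smul_mem' := by
    intro c a ha
    simp only [Set.mem_ofPred_eq] at *
    have h : op (c • a) = c * op a := rfl
    rw [h, mul_smul]
    exact L.smul_mem c ha

theorem mem_colonM (x : N) (L : Submodule Rᵐᵒᵖ N) (a : R) :
    a ∈ colonM R x L ↔ op a • x ∈ L := Iff.rfl

theorem colonM_map (f : N →ₗ[Rᵐᵒᵖ] P) (hf : Function.Injective f) (x : N)
    (L : Submodule Rᵐᵒᵖ N) : colonM R (f x) (L.map f) = colonM R x L := by
  ext a
  rw [mem_colonM, mem_colonM, ← map_smul]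
  constructor
  · rintro ⟨y, hy, hxy⟩
    rwa [← hf hxy]
  · intro h
    exact ⟨_, h, rfl⟩

/-- successive colon ideals all belong to `F`. -/
def FS (F : Set (Submodule Rᵐᵒᵖ R)) {n : ℕ} (v : Fin n → N) : Prop :=
  ∀ l, colonM R (v l) (Submodule.span Rᵐᵒᵖ (v '' Set.Iio l)) ∈ F

theorem FS_map {F : Set (Submodule Rᵐᵒᵖ R)} {n : ℕ} {v : Fin n → N} (hv : FS R F v)
    (f : N →ₗ[Rᵐᵒᵖ] P) (hf : Function.Injective f) : FS R F (fun l => f (v l)) := by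
  intro l
  have h : (fun l => f (v l)) '' Set.Iio l = f '' (v '' Set.Iio l) := by
    rw [Set.image_image]
  rw [h, Submodule.span_image, colonM_map R f hf]
  exact hv l

theorem range_snoc' {n : ℕ} (v : Fin n → N) (x : N) :
    Set.range (Fin.snoc v x : Fin (n + 1) → N) = Set.range v ∪ {x} := by
  ext z
  simp only [Set.mem_range, Set.mem_union, Set.mem_singleton_iff]
  constructor
  · rintro ⟨i, rfl⟩
    refine Fin.lastCases ?_ (fun i => ?_) i
    · right; simp
    · left; exact ⟨i, by simp⟩
  · rintro (⟨i, rfl⟩ | rfl)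
    · exact ⟨i.castSucc, by simp⟩
    · exact ⟨Fin.last n, by simp⟩

theorem image_castSucc_Iio {n : ℕ} (v : Fin (n + 1) → N) (l : Fin n) :
    v '' Set.Iio l.castSucc = (fun i : Fin n => v i.castSucc) '' Set.Iio l := by
  ext z
  constructor
  · rintro ⟨i, hi, rfl⟩
    have hi' : (i : ℕ) < l := hi
    exact ⟨⟨i, by omega⟩, hi', rfl⟩
  · rintro ⟨i, hi, rfl⟩
    exact ⟨i.castSucc, hi, rfl⟩

theorem image_last_Iio {n : ℕ} (v : Fin (n + 1) → N) :
    v '' Set.Iio (Fin.last n) = Set.range (fun i : Fin n => v i.castSucc) := by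
  ext z
  constructor
  · rintro ⟨i, hi, rfl⟩
    have hi' : (i : ℕ) < n := hi
    exact ⟨⟨i, hi'⟩, rfl⟩
  · rintro ⟨i, rfl⟩
    exact ⟨i.castSucc, Fin.castSucc_lt_last i, rfl⟩

theorem FS_succ {F : Set (Submodule Rᵐᵒᵖ R)} {n : ℕ} {v : Fin (n + 1) → N} :
    FS R F v ↔ FS R F (fun i : Fin n => v i.castSucc) ∧
      colonM R (v (Fin.last n))
        (Submodule.span Rᵐᵒᵖ (Set.range (fun i : Fin n => v i.castSucc))) ∈ F := by
  constructor
  · intro h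
    refine ⟨fun l => ?_, ?_⟩
    · rw [← image_castSucc_Iio]; exact h l.castSucc
    · rw [← image_last_Iio]; exact h _
  · rintro ⟨h1, h2⟩ l
    refine Fin.lastCases ?_ (fun i => ?_) l
    · rw [image_last_Iio]; exact h2
    · rw [image_castSucc_Iio]; exact h1 i

theorem FS_snoc {F : Set (Submodule Rᵐᵒᵖ R)} {n : ℕ} {v : Fin n → N} {x : N}
    (h1 : FS R F v) (h2 : colonM R x (Submodule.span Rᵐᵒᵖ (Set.range v)) ∈ F) :
    FS R F (Fin.snoc v x : Fin (n + 1) → N) := by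
  rw [FS_succ]
  simpa using ⟨h1, h2⟩

/-- the linear map from the free module sending basis vectors to `v`. -/
def lin {n : ℕ} (v : Fin n → N) : (Fin n → R) →ₗ[Rᵐᵒᵖ] N where
  toFun u := ∑ i, op (u i) • v i
  map_add' u w := by simp [add_smul, Finset.sum_add_distrib]
  map_smul' c u := by
    simp only [RingHom.id_apply, Finset.smul_sum]
    refine Finset.sum_congr rfl fun i _ => ?_
    have h : op ((c • u) i) = c * op (u i) := rfl
    rw [h, mul_smul]

theorem lin_apply {n : ℕ} (v : Fin n → N) (u : Fin n → R) :
    lin R v u = ∑ i, op (u i) • v i := rfl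

theorem mem_span_iff_lin {n : ℕ} (v : Fin n → N) (w : N) :
    w ∈ Submodule.span Rᵐᵒᵖ (Set.range v) ↔ ∃ u, lin R v u = w := by
  rw [Submodule.mem_span_range_iff_exists_fun]
  constructor
  · rintro ⟨c, hc⟩
    exact ⟨fun i => unop (c i), by rw [lin_apply]; simpa using hc⟩
  · rintro ⟨u, hu⟩
    exact ⟨fun i => op (u i), hu⟩

theorem solSpanBy_of {n m : ℕ} (v : Fin n → N) (h : Fin m → (Fin n → R))
    (hh : Submodule.span Rᵐᵒᵖ (Set.range h) = LinearMap.ker (lin R v)) :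
    SolSpanBy R N v h := by
  constructor
  · intro j
    have : h j ∈ LinearMap.ker (lin R v) := by
      rw [← hh]; exact Submodule.subset_span ⟨j, rfl⟩
    exact this
  · intro u hu
    rw [hh]; exact hu

/-- extension by zero in the last coordinate. -/
def ext0 (p : ℕ) : (Fin p → R) →ₗ[Rᵐᵒᵖ] (Fin (p + 1) → R) where
  toFun u := Fin.snoc (α := fun _ => R) u 0
  map_add' u w := by
    funext i
    refine Fin.lastCases ?_ (fun i => ?_) i <;> simp
  map_smul' c u := by
    funext i
    refine Fin.lastCases ?_ (fun i => ?_) i <;> simp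

@[simp] theorem ext0_castSucc (p : ℕ) (u : Fin p → R) (i : Fin p) :
    ext0 R p u i.castSucc = u i := by simp [ext0]

@[simp] theorem ext0_last (p : ℕ) (u : Fin p → R) :
    ext0 R p u (Fin.last p) = 0 := by simp [ext0]

theorem ext0_inj (p : ℕ) : Function.Injective (ext0 R p) := by
  intro u w h
  funext i
  rw [← ext0_castSucc R p u i, h, ext0_castSucc]

end Aux

section Graded

variable {k R}

/-- projection onto the homogeneous component of degree `j`. -/
theorem exists_proj_s14 {𝒜 : ℕ → Submodule k R} (hc : IsConnAlg k R 𝒜) :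
    ∃ pr : ℤ → R →+ R, (∀ j r, pr j r ∈ grZ k R 𝒜 j) ∧
      (∀ j, ∀ r ∈ grZ k R 𝒜 j, pr j r = r) ∧
      (∀ e, ∀ a ∈ grZ k R 𝒜 e, ∀ j b, pr j (a * b) = a * pr (j - e) b) ∧
      (∀ j < 0, ∀ r, pr j r = 0) := by
  classical
  obtain ⟨hm, hi, h0⟩ := hc
  let _ : SetLike.GradedMonoid 𝒜 :=
    { one_mem := by rw [h0]; exact Submodule.subset_span rfl
      mul_mem := fun i j x y hx hy => hm _ _ _ hx _ hy }
  let _ : DirectSum.Decomposition 𝒜 := hi.chooseDecomposition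
  let _ : GradedRing 𝒜 := {}
  refine ⟨fun j => if 0 ≤ j then GradedRing.proj 𝒜 j.toNat else 0, ?_, ?_, ?_, ?_⟩
  · intro j r
    by_cases hj : 0 ≤ j
    · simp [hj, grZ, GradedRing.proj_apply]
    · simp [hj, grZ]
  · intro j r hr
    by_cases hj : 0 ≤ j
    · simp only [grZ, hj, if_true] at hr
      simp only [hj, if_true, GradedRing.proj_apply]
      exact DirectSum.decompose_of_mem_same 𝒜 hr
    · simp only [grZ, hj, if_false, Submodule.mem_bot] at hr
      simp [hr]
  · intro e a ha j b
    by_cases he : 0 ≤ e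
    · simp only [grZ, he, if_true] at ha
      by_cases hj : 0 ≤ j
      · simp only [hj, if_true, GradedRing.proj_apply]
        rw [DirectSum.coe_decompose_mul_of_left_mem 𝒜 _ ha]
        by_cases hje : e ≤ j
        · have h1 : e.toNat ≤ j.toNat := by omega
          have h2 : 0 ≤ j - e := by omega
          have h3 : j.toNat - e.toNat = (j - e).toNat := by omega
          rw [if_pos h1, if_pos h2, h3, GradedRing.proj_apply]
        · have h1 : ¬ e.toNat ≤ j.toNat := by omega
          simp [h1, hje]
      · have h2 : ¬ 0 ≤ j - e := by omega
        simp only [if_neg hj, if_neg h2]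
        simp
    · simp only [grZ, he, if_false, Submodule.mem_bot] at ha
      simp [ha]
  · intro j hj r
    have : ¬ 0 ≤ j := by omega
    simp [this]

theorem grZ_mul_s14 {𝒜 : ℕ → Submodule k R} (hc : IsConnAlg k R 𝒜) {i j : ℤ} {a b : R}
    (ha : a ∈ grZ k R 𝒜 i) (hb : b ∈ grZ k R 𝒜 j) : a * b ∈ grZ k R 𝒜 (i + j) := by
  obtain ⟨pr, h1, h2, h3, h4⟩ := exists_proj_s14 hc
  have h := h3 i a ha (i + j) b
  rw [add_sub_cancel_left, h2 j b hb] at h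
  rw [← h]; exact h1 _ _

/-- homogeneous coefficients. -/
theorem homog_coeff {𝒜 : ℕ → Submodule k R} (hc : IsConnAlg k R 𝒜) {n p : ℕ}
    {dg : Fin n → ℤ} {v : Fin p → (Fin n → R)} {e : Fin p → ℤ}
    (hv : ∀ i, FreeHomog k R 𝒜 dg (v i) (e i)) {w : Fin n → R} {j : ℤ}
    (hw : FreeHomog k R 𝒜 dg w j) (hmem : w ∈ Submodule.span Rᵐᵒᵖ (Set.range v)) :
    ∃ b : Fin p → R, FreeHomog k R 𝒜 e b j ∧ lin R v b = w := by
  obtain ⟨pr, h1, h2, h3, h4⟩ := exists_proj_s14 hc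
  obtain ⟨u, hu⟩ := (mem_span_iff_lin R v w).1 hmem
  refine ⟨fun i => pr (j - e i) (u i), fun i => h1 _ _, ?_⟩
  funext s
  have hs := congrArg (fun z => pr (j - dg s) (z s)) hu
  simp only [h2 _ _ (hw s)] at hs
  rw [← hs, lin_apply, lin_apply]
  simp only [Finset.sum_apply, Pi.smul_apply, op_smul_eq_mul, map_sum]
  refine Finset.sum_congr rfl fun i _ => ?_
  rw [h3 _ _ (hv i s)]
  congr 2
  ring_nf

theorem proj_mem {𝒜 : ℕ → Submodule k R} {J : Submodule Rᵐᵒᵖ R}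
    (hJ : IsGradedSub k R R (grZ k R 𝒜) J) (pr : ℤ → R →+ R)
    (h3 : ∀ e, ∀ a ∈ grZ k R 𝒜 e, ∀ j b, pr j (a * b) = a * pr (j - e) b)
    {y : R} (hy : y ∈ J) (j : ℤ) : pr j y ∈ J := by
  have h := hJ hy
  clear hy
  induction h using Submodule.closure_induction with
  | zero => simp
  | add x y _ _ hx hy =>
    rw [map_add]; exact J.add_mem hx hy
  | smul_mem r x hx =>
    obtain ⟨hxJ, e, he⟩ := hx
    rw [← op_unop r, op_smul_eq_mul, h3 e x he, ← op_smul_eq_mul]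
    exact J.smul_mem _ hxJ

/-- the inner step: add the relations coming from one more generator. -/
theorem inner_step {𝒜 : ℕ → Submodule k R} (hc : IsConnAlg k R 𝒜)
    {F : Set (Submodule Rᵐᵒᵖ R)} {n p : ℕ} {dg : Fin n → ℤ}
    (v : Fin (p + 1) → (Fin n → R)) (e : Fin (p + 1) → ℤ)
    (hv : ∀ i, FreeHomog k R 𝒜 dg (v i) (e i))
    {q : ℕ} (h : Fin q → (Fin p → R)) (eh : Fin q → ℤ) (hFS : FS R F h)
    (hh : ∀ l, FreeHomog k R 𝒜 (fun i : Fin p => e i.castSucc) (h l) (eh l))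
    (hspan : Submodule.span Rᵐᵒᵖ (Set.range h) =
      LinearMap.ker (lin R (fun i : Fin p => v i.castSucc))) :
    ∀ (s : ℕ) (y : Fin s → R) (ey : Fin s → ℤ), (∀ t, y t ∈ grZ k R 𝒜 (ey t)) →
      FS R F y →
      (∀ t, op (y t) • v (Fin.last p) ∈
        Submodule.span Rᵐᵒᵖ (Set.range (fun i : Fin p => v i.castSucc))) →
      ∃ (q' : ℕ) (h' : Fin q' → (Fin (p + 1) → R)) (eh' : Fin q' → ℤ),
        FS R F h' ∧ (∀ l, FreeHomog k R 𝒜 e (h' l) (eh' l)) ∧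
        (Submodule.span Rᵐᵒᵖ (Set.range h') = LinearMap.ker (lin R v) ⊓
          (Submodule.span Rᵐᵒᵖ (Set.range y)).comap
            (LinearMap.proj (Fin.last p) : (Fin (p + 1) → R) →ₗ[Rᵐᵒᵖ] R)) ∧
        ∀ C : ℤ, (∀ l, eh l ≤ C) → (∀ t, e (Fin.last p) + ey t ≤ C) → ∀ l, eh' l ≤ C := by
  have hlin : ∀ u : Fin (p + 1) → R, lin R v u =
      lin R (fun i : Fin p => v i.castSucc) (fun i => u i.castSucc) +
        op (u (Fin.last p)) • v (Fin.last p) := by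
    intro u
    rw [lin_apply, lin_apply, Fin.sum_univ_castSucc]
  intro s
  induction s with
  | zero =>
    intro y ey _ _ _
    refine ⟨q, fun l => ext0 R p (h l), eh, FS_map R hFS _ (ext0_inj R p), ?_, ?_,
      fun C hC _ => hC⟩
    · intro l i
      refine Fin.lastCases ?_ (fun i => ?_) i
      · beta_reduce
        rw [ext0_last]; exact Submodule.zero_mem _
      · beta_reduce
        rw [ext0_castSucc]; exact hh l i
    · have hr : Set.range (fun l => ext0 R p (h l)) = ext0 R p '' Set.range h := by
        rw [← Set.range_comp]; rfl
      have hy : Set.range y = ∅ := Set.range_eq_empty y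
      rw [hr, Submodule.span_image, hspan, hy, Submodule.span_empty]
      ext u
      simp only [Submodule.mem_map, Submodule.mem_inf, LinearMap.mem_ker, Submodule.mem_comap,
        LinearMap.proj_apply, Submodule.mem_bot]
      constructor
      · rintro ⟨w, hw, rfl⟩
        refine ⟨?_, ext0_last R p w⟩
        rw [hlin]
        simp [hw]
      · rintro ⟨h1, h2⟩
        refine ⟨fun i => u i.castSucc, ?_, ?_⟩
        · rw [hlin, h2] at h1
          simpa using h1
        · funext i
          refine Fin.lastCases ?_ (fun i => ?_) i
          · rw [ext0_last, h2]
          · rw [ext0_castSucc]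
  | succ s ih =>
    intro y ey hy hyFS hmem
    rw [FS_succ] at hyFS
    obtain ⟨q', h', eh', hF', hg', hs', hb'⟩ := ih (fun t => y t.castSucc)
      (fun t => ey t.castSucc) (fun t => hy _) hyFS.1 (fun t => hmem _)
    set x := v (Fin.last p) with hx
    set yl := y (Fin.last s) with hyl
    have hxy : FreeHomog k R 𝒜 dg (op yl • x) (e (Fin.last p) + ey (Fin.last s)) := by
      intro i
      have := grZ_mul_s14 hc (hv (Fin.last p) i) (hy (Fin.last s))
      rw [Pi.smul_apply, op_smul_eq_mul]
      convert this using 2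
      ring
    obtain ⟨b, hb, hbl⟩ := homog_coeff hc (fun i : Fin p => hv i.castSucc) hxy (hmem _)
    set w : Fin (p + 1) → R := Fin.snoc (α := fun _ => R) (fun i => - b i) yl with hw
    have hwl : w (Fin.last p) = yl := by simp [hw]
    have hwc : (fun i : Fin p => w i.castSucc) = - b := by
      funext i; simp [hw]
    have hwsol : lin R v w = 0 := by
      rw [hlin, hwc, hwl, map_neg, hbl, neg_add_cancel]
    have hyspan : Submodule.span Rᵐᵒᵖ (Set.range y) =
        Submodule.span Rᵐᵒᵖ (Set.range (fun t : Fin s => y t.castSucc)) ⊔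
          Submodule.span Rᵐᵒᵖ {yl} := by
      rw [← Submodule.span_union, ← range_snoc']
      congr 2
      funext i
      refine Fin.lastCases ?_ (fun i => ?_) i <;> simp [hyl]
    refine ⟨q' + 1, Fin.snoc h' w,
      Fin.snoc (α := fun _ => ℤ) eh' (e (Fin.last p) + ey (Fin.last s)), ?_, ?_, ?_, ?_⟩
    · refine FS_snoc R hF' ?_
      convert hyFS.2 using 1
      rw [hs']
      ext a
      simp only [mem_colonM, Submodule.mem_inf, LinearMap.mem_ker, Submodule.mem_comap,
        map_smul, hwsol, smul_zero, true_and, LinearMap.proj_apply, hwl, hyl]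
    · intro l
      refine Fin.lastCases ?_ (fun l => ?_) l
      · rw [Fin.snoc_last, Fin.snoc_last]
        intro i
        refine Fin.lastCases ?_ (fun i => ?_) i
        · rw [hwl, add_sub_cancel_left]; exact hy _
        · have : w i.castSucc = - b i := congrFun hwc i
          rw [this]
          exact Submodule.neg_mem _ (hb i)
      · rw [Fin.snoc_castSucc, Fin.snoc_castSucc]
        exact hg' l
    · rw [range_snoc', Submodule.span_union, hs', hyspan]
      ext u
      constructor
      · intro hu
        obtain ⟨u1, hu1, u2, hu2, rfl⟩ := Submodule.mem_sup.1 hu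
        obtain ⟨c, rfl⟩ := Submodule.mem_span_singleton.1 hu2
        refine ⟨?_, ?_⟩
        · have := hu1.1
          simp only [SetLike.mem_coe, LinearMap.mem_ker] at this ⊢
          rw [map_add, map_smul, hwsol, this]; simp
        · have := hu1.2
          simp only [SetLike.mem_coe, Submodule.mem_comap, LinearMap.proj_apply] at this ⊢
          refine Submodule.add_mem_sup this ?_
          rw [Pi.smul_apply, hwl]
          exact Submodule.smul_mem _ _ (Submodule.mem_span_singleton_self _)
      · rintro ⟨h1, h2⟩
        simp only [SetLike.mem_coe, LinearMap.mem_ker, Submodule.mem_comap,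
          LinearMap.proj_apply] at h1 h2
        obtain ⟨z, hz, z2, hz2, hzz⟩ := Submodule.mem_sup.1 h2
        obtain ⟨c, rfl⟩ := Submodule.mem_span_singleton.1 hz2
        have hu : u = (u - c • w) + c • w := by abel
        rw [hu]
        refine Submodule.add_mem_sup ⟨?_, ?_⟩
          (Submodule.smul_mem _ _ (Submodule.mem_span_singleton_self _))
        · simp only [SetLike.mem_coe, LinearMap.mem_ker]
          rw [map_sub, map_smul, hwsol, h1]; simp
        · simp only [SetLike.mem_coe, Submodule.mem_comap, LinearMap.proj_apply]
          rw [Pi.sub_apply, Pi.smul_apply, hwl, ← hzz, add_sub_cancel_right]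
          exact hz
    · intro C h1 h2 l
      refine Fin.lastCases ?_ (fun l => ?_) l
      · rw [Fin.snoc_last]; exact h2 _
      · rw [Fin.snoc_castSucc]; exact hb' C h1 (fun t => h2 _) l

/-- good generating sequence of an ideal in the family. -/
def GoodGen (𝒜 : ℕ → Submodule k R) (F : Set (Submodule Rᵐᵒᵖ R))
    (I : Submodule Rᵐᵒᵖ R) : Prop :=
  ∃ (s : ℕ) (y : Fin s → R) (ey : Fin s → ℤ), (∀ t, y t ∈ grZ k R 𝒜 (ey t)) ∧
    FS R F y ∧ Submodule.span Rᵐᵒᵖ (Set.range y) = I ∧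
    ∀ m : ℤ, GenLE k R R (grZ k R 𝒜) I m → ∀ t, ey t ≤ m

theorem outer_step {𝒜 : ℕ → Submodule k R} (hc : IsConnAlg k R 𝒜)
    {F : Set (Submodule Rᵐᵒᵖ R)} (hgood : ∀ I ∈ F, GoodGen 𝒜 F I)
    {n : ℕ} {dg : Fin n → ℤ} :
    ∀ (p : ℕ) (v : Fin p → (Fin n → R)) (e : Fin p → ℤ),
    (∀ i, FreeHomog k R 𝒜 dg (v i) (e i)) → FS R F v →
    ∃ (q : ℕ) (h : Fin q → (Fin p → R)) (eh : Fin q → ℤ), FS R F h ∧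
      (∀ l, FreeHomog k R 𝒜 e (h l) (eh l)) ∧
      Submodule.span Rᵐᵒᵖ (Set.range h) = LinearMap.ker (lin R v) ∧
      ∀ d : ℕ, CohFamDegLE k R 𝒜 F d → ∀ C : ℤ, (∀ i, e i ≤ C) → ∀ l, eh l ≤ C + d := by
  intro p
  induction p with
  | zero =>
    intro v e _ _
    refine ⟨0, Fin.elim0, Fin.elim0, fun l => l.elim0, fun l => l.elim0, ?_,
      fun _ _ _ _ l => l.elim0⟩
    exact Subsingleton.elim _ _
  | succ p ih =>
    intro v e hv hFS
    rw [FS_succ] at hFS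
    obtain ⟨q, h, eh, h1, h2, h3, h4⟩ := ih (fun i => v i.castSucc) (fun i => e i.castSucc)
      (fun i => hv _) hFS.1
    obtain ⟨s, y, ey, hy1, hy2, hy3, hy4⟩ := hgood _ hFS.2
    obtain ⟨q', h', eh', g1, g2, g3, g4⟩ := inner_step hc v e hv h eh h1 h2 h3 s y ey hy1 hy2
      (fun t => by
        have : y t ∈ Submodule.span Rᵐᵒᵖ (Set.range y) := Submodule.subset_span ⟨t, rfl⟩
        rw [hy3] at this
        exact this)
    refine ⟨q', h', eh', g1, g2, ?_, ?_⟩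
    · rw [g3, hy3, inf_eq_left]
      intro u hu
      rw [LinearMap.mem_ker, lin_apply, Fin.sum_univ_castSucc] at hu
      rw [Submodule.mem_comap, LinearMap.proj_apply, mem_colonM,
        ← neg_eq_of_add_eq_zero_right hu]
      refine Submodule.neg_mem _ ?_
      rw [mem_span_iff_lin]
      exact ⟨fun i => u i.castSucc, rfl⟩
    · intro d hd C hC
      refine g4 _ (h4 d hd C fun i => hC _) fun t => ?_
      exact add_le_add (hC _) (hy4 _ (hd _ hFS.2) t)

/-- degree of the last generator. -/
theorem deg_le {𝒜 : ℕ → Submodule k R} (hc : IsConnAlg k R 𝒜)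
    {I J : Submodule Rᵐᵒᵖ R} (hJ : IsGradedSub k R R (grZ k R 𝒜) J) (hne : J ≠ I)
    {x : R} {dx : ℤ} (hx : x ∈ grZ k R 𝒜 dx) (hI : I = J ⊔ Submodule.span Rᵐᵒᵖ {x})
    {m : ℤ} (hm : GenLE k R R (grZ k R 𝒜) I m) : dx ≤ m := by
  by_contra hlt
  push Not at hlt
  obtain ⟨pr, h1, h2, h3, h4⟩ := exists_proj_s14 hc
  refine hne (le_antisymm (hI ▸ le_sup_left) (hm.trans (Submodule.span_le.2 ?_)))
  rintro z ⟨hz, j, hj, hzj⟩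
  rw [hI] at hz
  obtain ⟨y, hy, w, hw, rfl⟩ := Submodule.mem_sup.1 hz
  obtain ⟨c, rfl⟩ := Submodule.mem_span_singleton.1 hw
  rw [SetLike.mem_coe, ← h2 j _ hzj, map_add, ← op_unop c, op_smul_eq_mul, h3 _ _ hx,
    h4 (j - dx) (by omega), mul_zero, add_zero]
  exact proj_mem hJ pr h3 hy j

theorem genLE_of_fg {𝒜 : ℕ → Submodule k R} {I : Submodule Rᵐᵒᵖ R} (hfg : I.FG)
    (hI : IsGradedSub k R R (grZ k R 𝒜) I) : ∃ m : ℤ, GenLE k R R (grZ k R 𝒜) I m := by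
  have hIe : I = Submodule.span Rᵐᵒᵖ {x : R | x ∈ I ∧ ∃ j : ℤ, x ∈ grZ k R 𝒜 j} :=
    le_antisymm hI (Submodule.span_le.2 fun x hx => hx.1)
  have hfg' := hfg
  rw [hIe, Submodule.fg_span_iff_fg_span_finset_subset] at hfg'
  obtain ⟨S, hS, hSe⟩ := hfg'
  rw [← hIe] at hSe
  choose! f hf using fun x (hx : x ∈ S) => (hS hx).2
  obtain ⟨m, hm⟩ := (S.finite_toSet.image f).bddAbove
  refine ⟨m, ?_⟩
  unfold GenLE
  conv_lhs => rw [hSe]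
  refine Submodule.span_mono fun x hx => ?_
  exact ⟨(hS hx).1, f x, hm ⟨x, hx, rfl⟩, hf x hx⟩

theorem goodGen_aux {𝒜 : ℕ → Submodule k R} (hc : IsConnAlg k R 𝒜) (hlf : LocFin k R 𝒜)
    {F : Set (Submodule Rᵐᵒᵖ R)} (hF : IsCohFam k R 𝒜 F) (m : ℤ) (W : Submodule k R)
    [FiniteDimensional k W] (hW : ∀ j ≤ m, grZ k R 𝒜 j ≤ W) :
    ∀ (c : ℕ) (I : Submodule Rᵐᵒᵖ R), I ∈ F → GenLE k R R (grZ k R 𝒜) I m →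
      Module.finrank k ↥(W ⊓ I.restrictScalars k) = c → GoodGen 𝒜 F I := by
  intro c
  induction c using Nat.strong_induction_on with
  | _ c ih =>
  intro I hIF hIm hcI
  obtain ⟨hF1, hF2, hF3, hF4⟩ := hF
  by_cases hI0 : I = ⊥
  · subst hI0
    refine ⟨0, Fin.elim0, Fin.elim0, fun l => l.elim0, fun l => l.elim0, ?_,
      fun _ _ l => l.elim0⟩
    rw [Set.range_eq_empty, Submodule.span_empty]
  obtain ⟨J, hJF, hJI, x, ⟨dx, hdx⟩, hxI, hIe, hJm, hcol⟩ := hF4 I hIF hI0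
  have hxz : x ∈ grZ k R 𝒜 (dx : ℤ) := by simpa [grZ] using hdx
  have hle : J ≤ I := by rw [hIe]; exact le_sup_left
  have hlt : W ⊓ J.restrictScalars k < W ⊓ I.restrictScalars k := by
    refine lt_of_le_of_ne (inf_le_inf_left _ fun z hz => hle hz) fun heq => ?_
    refine hJI (le_antisymm hle (hIm.trans (Submodule.span_le.2 ?_)))
    rintro z ⟨hz, j, hj, hzj⟩
    have : z ∈ W ⊓ I.restrictScalars k := ⟨hW j hj hzj, hz⟩
    rw [← heq] at this
    exact this.2
  haveI : FiniteDimensional k ↥(W ⊓ I.restrictScalars k) :=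
    Submodule.finiteDimensional_of_le inf_le_left
  have hfr := Submodule.finrank_lt_finrank_of_lt hlt
  obtain ⟨s, y, ey, hy1, hy2, hy3, hy4⟩ := ih _ (hcI ▸ hfr) J hJF (hJm m hIm) rfl
  refine ⟨s + 1, Fin.snoc y x, Fin.snoc (α := fun _ => ℤ) ey dx, ?_, ?_, ?_, ?_⟩
  · intro t
    refine Fin.lastCases ?_ (fun t => ?_) t
    · rw [Fin.snoc_last, Fin.snoc_last]; exact hxz
    · rw [Fin.snoc_castSucc, Fin.snoc_castSucc]; exact hy1 t
  · refine FS_snoc R hy2 ?_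
    rw [hy3]
    exact hcol
  · rw [range_snoc', Submodule.span_union, hy3, hIe]
  · intro m' hm' t
    refine Fin.lastCases ?_ (fun t => ?_) t
    · rw [Fin.snoc_last]; exact deg_le hc (hF1 J hJF).2 hJI hxz hIe hm'
    · rw [Fin.snoc_castSucc]; exact hy4 _ (hJm _ hm') t

theorem goodGen {𝒜 : ℕ → Submodule k R} (hc : IsConnAlg k R 𝒜) (hlf : LocFin k R 𝒜)
    {F : Set (Submodule Rᵐᵒᵖ R)} (hF : IsCohFam k R 𝒜 F) (I : Submodule Rᵐᵒᵖ R)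
    (hI : I ∈ F) : GoodGen 𝒜 F I := by
  obtain ⟨m, hm⟩ := genLE_of_fg (hF.1 I hI).1 (hF.1 I hI).2
  haveI : ∀ i, FiniteDimensional k (𝒜 i) := hlf
  refine goodGen_aux hc hlf hF m (⨆ i : Fin (m.toNat + 1), 𝒜 i) ?_ _ I hI hm rfl
  intro j hj
  unfold grZ
  split_ifs with h
  · exact le_iSup (fun i : Fin (m.toNat + 1) => 𝒜 i) ⟨j.toNat, by omega⟩
  · exact bot_le

/-- a stage of the construction of the resolution. -/
structure Stage (𝒜 : ℕ → Submodule k R) (F : Set (Submodule Rᵐᵒᵖ R)) : Type where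
  n : ℕ
  p : ℕ
  dg : Fin n → ℤ
  e : Fin p → ℤ
  v : Fin p → (Fin n → R)
  hom : ∀ i, FreeHomog k R 𝒜 dg (v i) (e i)
  fs : FS R F v

theorem resolution {𝒜 : ℕ → Submodule k R} (hc : IsConnAlg k R 𝒜)
    {F : Set (Submodule Rᵐᵒᵖ R)} (hgood : ∀ I ∈ F, GoodGen 𝒜 F I) (I : Submodule Rᵐᵒᵖ R)
    (hI : I ∈ F) :
    (∃ B : ℕ → ℤ, FreeResBdd k R 𝒜 I B) ∧
    ∀ d : ℕ, CohFamDegLE k R 𝒜 F d → ∀ m : ℤ, GenLE k R R (grZ k R 𝒜) I m →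
      FreeResBdd k R 𝒜 I (fun i => m + (d : ℤ) * i) := by
  obtain ⟨s, y, ey, hy1, hy2, hy3, hy4⟩ := hgood I hI
  choose q h eh h1 h2 h3 h4 using fun S : Stage 𝒜 F =>
    outer_step hc hgood S.p S.v S.e S.hom S.fs
  let emb : R →ₗ[Rᵐᵒᵖ] (Fin 1 → R) := LinearMap.pi fun _ => LinearMap.id
  have hemb : Function.Injective emb := fun a b hab => congrFun hab 0
  let S0 : Stage 𝒜 F :=
    { n := 1, p := s, dg := fun _ => 0, e := ey, v := fun l => emb (y l)
      hom := fun i j => by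
        have : emb (y i) j = y i := rfl
        rw [this, sub_zero]; exact hy1 i
      fs := FS_map R hy2 emb hemb }
  let nxt : Stage 𝒜 F → Stage 𝒜 F := fun S =>
    { n := S.p, p := q S, dg := S.e, e := eh S, v := h S, hom := h2 S, fs := h1 S }
  let st : ℕ → Stage 𝒜 F := fun i => Nat.rec S0 (fun _ S => nxt S) i
  have key : ∀ B : ℕ → ℤ, (∀ i l, (st i).e l ≤ B i) → FreeResBdd k R 𝒜 I B := by
    intro B hB
    refine ⟨fun i => (st i).p, fun i => (st i).e, y, fun i => h (st i), hB 0, hy1, hy3,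
      fun i l => hB (i + 1) l, fun i l => h2 (st i) l, ?_, ?_⟩
    · refine solSpanBy_of R y (h S0) ?_
      rw [h3 S0]
      ext u
      have : lin R S0.v u = emb (lin R y u) := by
        rw [lin_apply, lin_apply, map_sum]
        simp only [map_smul]
        rfl
      rw [LinearMap.mem_ker, LinearMap.mem_ker, this]
      exact map_eq_zero_iff emb hemb
    · intro i
      exact solSpanBy_of R (h (st i)) (h (st (i + 1))) (h3 (st (i + 1)))
  refine ⟨?_, ?_⟩
  · have : ∀ i, ∃ b : ℤ, ∀ l, (st i).e l ≤ b := fun i => by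
      obtain ⟨b, hb⟩ := (Set.finite_range (st i).e).bddAbove
      exact ⟨b, fun l => hb ⟨l, rfl⟩⟩
    choose B hB using this
    exact ⟨B, key B hB⟩
  · intro d hd m hm
    refine key _ fun i => ?_
    induction i with
    | zero =>
      intro l
      have h0 : ey l ≤ m + (d : ℤ) * ((0 : ℕ) : ℤ) := by simpa using hy4 m hm l
      exact h0
    | succ i ih =>
      intro l
      have := h4 (st i) d hd _ ih l
      refine this.trans (le_of_eq ?_)
      push_cast
      ring

theorem aug_genLE {𝒜 : ℕ → Submodule k R} (hg : ∀ n : ℕ, 𝒜 (n + 1) = 𝒜 n * 𝒜 1) :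
    GenLE k R R (grZ k R 𝒜) (aug k R 𝒜) 1 := by
  have hmem : ∀ z ∈ 𝒜 1, z ∈ Submodule.span Rᵐᵒᵖ
      {x : R | x ∈ aug k R 𝒜 ∧ ∃ j ≤ (1 : ℤ), x ∈ grZ k R 𝒜 j} := by
    intro z hz
    refine Submodule.subset_span ⟨Submodule.subset_span ?_, 1, le_refl _, by simpa [grZ] using hz⟩
    simp only [Set.mem_iUnion]
    exact ⟨1, le_refl _, hz⟩
  have hall : ∀ n, ∀ z ∈ 𝒜 (n + 1), z ∈ Submodule.span Rᵐᵒᵖ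
      {x : R | x ∈ aug k R 𝒜 ∧ ∃ j ≤ (1 : ℤ), x ∈ grZ k R 𝒜 j} := by
    intro n
    induction n with
    | zero => exact hmem
    | succ n ih =>
      intro z hz
      rw [hg (n + 1)] at hz
      refine Submodule.mul_induction_on hz (fun a ha b _ => ?_) fun a b ha hb =>
        Submodule.add_mem _ ha hb
      rw [← op_smul_eq_mul]
      exact Submodule.smul_mem _ _ (ih a ha)
  refine Submodule.span_le.2 ?_
  intro z hz
  simp only [Set.mem_iUnion] at hz
  obtain ⟨i, hi, hz⟩ := hz
  obtain ⟨n, rfl⟩ : ∃ n, i = n + 1 := ⟨i - 1, by omega⟩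
  exact hall n z hz

end Graded

/-- over an algebra with a coherent family `F`, the trivial module and
every ideal of `F` admit free resolutions of finite type; if `F` has degree at most
`d` the resolutions can be chosen with the stated degree bounds. -/
theorem statement_14 (k R : Type) [Field k] [Ring R] [Algebra k R]
    (𝒜 : ℕ → Submodule k R) (hconn : IsConnAlg k R 𝒜) (hlf : LocFin k R 𝒜)
    (hfga : FinGenAlg k R)
    (F : Set (Submodule Rᵐᵒᵖ R)) (hF : IsCohFam k R 𝒜 F) :
    ((∀ I ∈ F, ∃ B : ℕ → ℤ, FreeResBdd k R 𝒜 I B) ∧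
     (∃ B : ℕ → ℤ, FreeResBdd k R 𝒜 (aug k R 𝒜) B)) ∧
    (∀ d : ℕ, CohFamDegLE k R 𝒜 F d →
      ((∀ I ∈ F, ∀ mI : ℤ, GenLE k R R (grZ k R 𝒜) I mI →
          FreeResBdd k R 𝒜 I (fun i => mI + (d : ℤ) * i)) ∧
       ((∀ n : ℕ, 𝒜 (n + 1) = 𝒜 n * 𝒜 1) →
          FreeResBdd k R 𝒜 (aug k R 𝒜) (fun i => 1 + (d : ℤ) * i)))) := by
  have hr := resolution hconn (goodGen hconn hlf hF)
  have ha : aug k R 𝒜 ∈ F := hF.2.2.1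
  refine ⟨⟨fun I hI => (hr I hI).1, (hr _ ha).1⟩, fun d hd => ⟨fun I hI => (hr I hI).2 d hd, ?_⟩⟩
  intro hg
  exact (hr _ ha).2 d hd 1 (aug_genLE hg)

end NCG
end
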